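/- arXiv:1804.09809 — 2 statements merged into one kernel-verified Lean document; each statement's English description precedes it below -/
import Mathlib

section
/- (Effective avoidance via the Lovász Local Lemma, partial-function version.) For each rational q with 0 < q < 1 there is an M ∈ ℕ such that the following holds. Let σ : ℕ → Finset (ℕ × Bool) be a computable sequence such that each σ j is the graph of a partial function (i.e., if (n, b) ∈ σ j and (n, b') ∈ σ j then b = b') of size at least M, where the size of σ j is the cardinality of its domain dom (σ j) = {n | ∃ b, (n, b) ∈ σ j}. Suppose there is a computable function G : ℕ → ℕ → Finset ℕ such that for each m ≥ M and each n, G m n is exactly the set {j | σ j has size m ∧ n ∈ dom (σ j)}, and this set has at most 2^(q·m) elements (real exponential). Then there is a computable coloring c : ℕ → Bool such that for each j there is a pair (n, b) ∈ σ j with c n = b. -/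
/-- The domain of a finite partial function `ℕ → Bool` represented by its graph. -/
def pdom (σ : Finset (ℕ × Bool)) : Finset ℕ := σ.image Prod.fst

section Toolkit

variable {α β γ δ : Type*} [Primcodable α] [Primcodable β] [Primcodable γ] [Primcodable δ]

theorem Computable.list_foldl {f : α → List β} {g : α → γ} {h : α → γ × β → γ}
    (hf : Computable f) (hg : Computable g) (hh : Computable₂ h) :
    Computable fun a => (f a).foldl (fun c b => h a (c, b)) (g a) := by
  have key : Computable fun a => Nat.rec (motive := fun _ => γ) (g a)
      (fun i c => Option.casesOn (motive := fun _ => γ) ((f a)[i]?) c (fun b => h a (c, b)))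
      (f a).length := by
    refine Computable.nat_rec (f := fun a => (f a).length) (g := g)
      (h := fun a (p : ℕ × γ) => Option.casesOn (motive := fun _ => γ) ((f a)[p.1]?) p.2
        (fun b => h a (p.2, b))) (Computable.list_length.comp hf) hg ?_
    refine Computable.option_casesOn (o := fun q : α × ℕ × γ => (f q.1)[q.2.1]?)
      (f := fun q => q.2.2) (g := fun q b => h q.1 (q.2.2, b)) ?_ ?_ ?_
    · exact Computable.list_getElem?.comp (hf.comp .fst) (Computable.fst.comp .snd)
    · exact Computable.snd.comp .snd
    · exact hh.comp (Computable.fst.comp .fst)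
        (Computable.pair (Computable.snd.comp (Computable.snd.comp .fst)) .snd)
  refine key.of_eq fun a => ?_
  have aux : ∀ n, Nat.rec (motive := fun _ => γ) (g a)
      (fun i c => Option.casesOn (motive := fun _ => γ) ((f a)[i]?) c (fun b => h a (c, b))) n
      = ((f a).take n).foldl (fun c b => h a (c, b)) (g a) := by
    intro n
    induction n with
    | zero => simp
    | succ n ih =>
      simp only [ih, List.take_add_one, List.foldl_append]
      cases (f a)[n]? <;> simp
  rw [aux, List.take_length]

theorem Computable.list_flatMap {f : α → List β} {g : α → β → List γ}
    (hf : Computable f) (hg : Computable₂ g) : Computable fun a => (f a).flatMap (g a) := by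
  refine (Computable.list_foldl (h := fun a (p : List γ × β) => p.1 ++ g a p.2) hf
    (Computable.const []) ?_).of_eq fun a => ?_
  · exact Computable.list_append.comp (Computable.fst.comp .snd)
      (hg.comp .fst (Computable.snd.comp .snd))
  · have : ∀ (l : List β) (i : List γ),
        l.foldl (fun c b => c ++ g a b) i = i ++ l.flatMap (g a) := by
      intro l
      induction l with
      | nil => simp
      | cons b l ih => intro i; simp [ih]
    simp [this]

theorem Computable.list_map {f : α → List β} {g : α → β → γ}
    (hf : Computable f) (hg : Computable₂ g) : Computable fun a => (f a).map (g a) := by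
  refine (Computable.list_flatMap (g := fun a b => [g a b]) hf ?_).of_eq fun a => ?_
  · exact Computable.list_cons.comp hg (Computable.const [])
  · induction f a with
    | nil => simp
    | cons b l ih => simp_all

theorem Computable.list_all {f : α → List β} {g : α → β → Bool}
    (hf : Computable f) (hg : Computable₂ g) : Computable fun a => (f a).all (g a) := by
  refine (Computable.list_foldl (h := fun a (p : Bool × β) => p.1 && g a p.2) hf
    (Computable.const true) ?_).of_eq fun a => ?_
  · exact (Primrec.and.to_comp).comp (Computable.fst.comp .snd)
      (hg.comp .fst (Computable.snd.comp .snd))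
  · have : ∀ (l : List β) (i : Bool),
        l.foldl (fun c b => c && g a b) i = (i && l.all (g a)) := by
      intro l
      induction l with
      | nil => simp
      | cons b l ih => intro i; simp [ih, Bool.and_assoc]
    simp [this]

theorem Computable.list_find? {f : α → List β} {g : α → β → Bool}
    (hf : Computable f) (hg : Computable₂ g) : Computable fun a => (f a).find? (g a) := by
  refine (Computable.list_foldl (γ := Option β)
    (h := fun a (p : Option β × β) => Option.casesOn (motive := fun _ => Option β) p.1
      (bif g a p.2 then some p.2 else none) some) hf (Computable.const none) ?_).of_eq fun a => ?_
  · refine Computable.option_casesOn (o := fun q : α × Option β × β => q.2.1)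
      (f := fun q => bif g q.1 q.2.2 then some q.2.2 else none) (g := fun _ b => some b) ?_ ?_ ?_
    · exact Computable.fst.comp .snd
    · exact Computable.cond (hg.comp .fst (Computable.snd.comp .snd))
        (Computable.option_some.comp (Computable.snd.comp .snd)) (Computable.const none)
    · exact Computable.option_some.comp Computable.snd
  · have : ∀ (l : List β) (i : Option β),
        l.foldl (fun c b => Option.casesOn (motive := fun _ => Option β) c
          (bif g a b then some b else none) some) i = i.or (l.find? (g a)) := by
      intro l
      induction l with
      | nil => simp
      | cons b l ih =>
        intro i
        rw [List.foldl_cons, ih, List.find?_cons]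
        cases i <;> cases g a b <;> simp
    simp [this]

theorem Computable.list_sum {f : α → List ℕ} (hf : Computable f) :
    Computable fun a => (f a).sum := by
  refine (Computable.list_foldl (h := fun _ (p : ℕ × ℕ) => p.1 + p.2) hf
    (Computable.const 0) ?_).of_eq fun a => ?_
  · exact (Primrec.nat_add.to_comp).comp (Computable.fst.comp .snd) (Computable.snd.comp .snd)
  · rw [List.sum_eq_foldl]

theorem Computable.list_prod {f : α → List ℕ} (hf : Computable f) :
    Computable fun a => (f a).prod := by
  refine (Computable.list_foldl (h := fun _ (p : ℕ × ℕ) => p.1 * p.2) hf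
    (Computable.const 1) ?_).of_eq fun a => ?_
  · exact (Primrec.nat_mul.to_comp).comp (Computable.fst.comp .snd) (Computable.snd.comp .snd)
  · rw [List.prod_eq_foldl]

theorem Computable.list_count {f : α → List ℕ} {g : α → ℕ} (hf : Computable f)
    (hg : Computable g) : Computable fun a => (f a).count (g a) := by
  refine (Computable.list_sum (Computable.list_map
    (g := fun a b => bif b == g a then 1 else 0) hf ?_)).of_eq fun a => ?_
  · exact Computable.cond ((Primrec.beq (α := ℕ)).to_comp.comp Computable.snd (hg.comp .fst))
      (Computable.const 1) (Computable.const 0)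
  · induction f a with
    | nil => simp
    | cons b l ih =>
      rw [List.map_cons, List.sum_cons, ih, List.count_cons]
      cases b == g a <;> simp [Nat.add_comm]

theorem Computable.nat_find {p : α → ℕ → Bool} (hp : Computable₂ p) (h : ∀ a, ∃ n, p a n = true) :
    Computable fun a => Nat.find (h a) := by
  refine (Partrec.rfind (p := fun a n => Part.some (p a n)) hp.partrec₂).of_eq_tot fun a => ?_
  refine Nat.mem_rfind.2 ⟨?_, fun {m} hm => ?_⟩
  · simpa using (Nat.find_spec (h a)).symm
  · simpa using (Nat.find_min (h a) hm)

end Toolkit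

section Encodings

theorem Encodable.encode_finset_eq {α : Type*} [Encodable α] (s : Finset α) :
    ∃ l : List α, l.Nodup ∧ (∀ a, a ∈ l ↔ a ∈ s) ∧ Encodable.encode s = Encodable.encode l := by
  refine ⟨s.1.sort (Order.Preimage (Encodable.encode' α) (· ≤ ·)), ?_, ?_, rfl⟩
  · rw [← Multiset.coe_nodup, Multiset.sort_eq]; exact s.2
  · intro a; simp

theorem Computable.exists_list_of_encode_finset {σ : ℕ → Finset (ℕ × Bool)}
    (h : Computable fun j => Encodable.encode (σ j)) :
    ∃ vs : ℕ → List (ℕ × Bool), Computable vs ∧ ∀ j, (vs j).Nodup ∧ ∀ e, e ∈ vs j ↔ e ∈ σ j := by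
  choose l hl using fun j => Encodable.encode_finset_eq (σ j)
  refine ⟨l, ?_, fun j => ⟨(hl j).1, (hl j).2.1⟩⟩
  refine Computable.encode_iff.1 (h.of_eq fun j => (hl j).2.2)

theorem Denumerable.mem_raise'_encode (s : Finset ℕ) (a : ℕ) :
    a ∈ Denumerable.raise' (Denumerable.ofNat (List ℕ)
      (@Encodable.encode _ Denumerable.finset.toEncodable s)) 0 ↔ a ∈ s := by
  have := Denumerable.ofNat_encode s
  conv_rhs => rw [← this]
  change _ ↔ a ∈ Finset.map (Denumerable.eqv ℕ).symm.toEmbedding (Denumerable.raise'Finset _ 0)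
  simp only [Finset.mem_map_equiv, Equiv.symm_symm]
  rfl

theorem Primrec.raise' : Primrec fun l : List ℕ => Denumerable.raise' l 0 := by
  have : Primrec fun l : List ℕ => (l.foldl (fun (p : List ℕ × ℕ) m =>
      (p.1 ++ [m + p.2], m + p.2 + 1)) ([], 0)).1 := by
    refine Primrec.fst.comp (Primrec.list_foldl (h := fun _ (q : (List ℕ × ℕ) × ℕ) =>
      (q.1.1 ++ [q.2 + q.1.2], q.2 + q.1.2 + 1)) Primrec.id (Primrec.const _) ?_)
    have h1 : Primrec fun q : List ℕ × (List ℕ × ℕ) × ℕ => q.2.2 + q.2.1.2 :=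
      Primrec.nat_add.comp (Primrec.snd.comp .snd) (Primrec.snd.comp (Primrec.fst.comp .snd))
    exact Primrec.pair (Primrec.list_append.comp (Primrec.fst.comp (Primrec.fst.comp .snd))
      (Primrec.list_cons.comp h1 (Primrec.const []))) (Primrec.succ.comp h1)
  refine this.of_eq fun l => ?_
  have aux : ∀ (l : List ℕ) (p : List ℕ) (n : ℕ), (l.foldl (fun (p : List ℕ × ℕ) m =>
      (p.1 ++ [m + p.2], m + p.2 + 1)) (p, n)).1 = p ++ Denumerable.raise' l n := by
    intro l
    induction l with
    | nil => simp [Denumerable.raise']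
    | cons m l ih => intro p n; simp [Denumerable.raise', ih]
  simp [aux]

theorem Computable₂.exists_list_of_finset {G : ℕ → ℕ → Finset ℕ} (h : Computable₂ G) :
    ∃ g : ℕ → ℕ → List ℕ, Computable₂ g ∧ ∀ m n, (g m n).Nodup ∧ ∀ j, j ∈ g m n ↔ j ∈ G m n := by
  refine ⟨fun m n => Denumerable.raise' (Denumerable.ofNat (List ℕ)
    (@Encodable.encode _ Denumerable.finset.toEncodable (G m n))) 0,
    ?_, fun m n => ⟨(Denumerable.raise'_sorted _ _).nodup, Denumerable.mem_raise'_encode _⟩⟩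
  exact Primrec.raise'.to_comp.comp ((Computable.ofNat (List ℕ)).comp
    (Computable.encode.comp (show Computable fun p : ℕ × ℕ => G p.1 p.2 from h)))

end Encodings

namespace PartialEvent

/-- Twice the conditional probability, given the prefix `p`, that a random bit sequence takes the
value `e.2` at position `e.1`. -/
def entryWeight (p : List Bool) (e : ℕ × Bool) : ℕ :=
  Option.casesOn (p[e.1]?) 1 (fun b => bif b == e.2 then 2 else 0)

/-- `2 ^ r.length` times the conditional probability, given the prefix `p`, that a random bit
sequence extends the partial function `r`. -/
def weight (p : List Bool) (r : List (ℕ × Bool)) : ℕ := (r.map (entryWeight p)).prod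

/-- The expected number, given the prefix `p`, of members of `R` extended by a random bit
sequence. -/
def expected (R : List (List (ℕ × Bool))) (p : List Bool) : ℚ :=
  (R.map fun r => (weight p r : ℚ) * (1 / 2) ^ r.length).sum

/-- `expected R p`, scaled to a natural number. -/
def score (R : List (List (ℕ × Bool))) (p : List Bool) : ℕ :=
  (R.map fun r => weight p r * 2 ^ ((R.map List.length).sum - r.length)).sum

theorem score_eq (R : List (List (ℕ × Bool))) (p : List Bool) :
    (score R p : ℚ) = 2 ^ (R.map List.length).sum * expected R p := by
  rw [score, expected, ← List.sum_map_mul_left, Nat.cast_list_sum, List.map_map]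
  refine congrArg List.sum (List.map_congr_left fun r hr => ?_)
  have h : r.length ≤ (R.map List.length).sum :=
    List.single_le_sum (fun _ _ => Nat.zero_le _) _ (List.mem_map_of_mem hr)
  obtain ⟨d, hd⟩ := Nat.exists_eq_add_of_le h
  simp only [Function.comp, hd]
  rw [Nat.add_sub_cancel_left, pow_add]
  push_cast
  have : (2 : ℚ) ^ r.length * (1 / 2) ^ r.length = 1 := by rw [← mul_pow]; norm_num
  linear_combination (-(weight p r : ℚ) * 2 ^ d) * this

theorem entryWeight_append_of_ne {p : List Bool} {e : ℕ × Bool} (b : Bool) (h : e.1 ≠ p.length) :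
    entryWeight (p ++ [b]) e = entryWeight p e := by
  unfold entryWeight
  rcases lt_or_gt_of_ne h with h | h
  · rw [List.getElem?_append_left h]
  · rw [List.getElem?_eq_none (by simp; omega), List.getElem?_eq_none (by omega)]

theorem weight_append_of_notMem {p : List Bool} {r : List (ℕ × Bool)} (b : Bool)
    (h : p.length ∉ r.map Prod.fst) : weight (p ++ [b]) r = weight p r := by
  unfold weight
  refine congrArg List.prod (List.map_congr_left fun e he => ?_)
  exact entryWeight_append_of_ne b fun h' => h (h' ▸ List.mem_map_of_mem he)

theorem weight_append_add {r : List (ℕ × Bool)} (hr : (r.map Prod.fst).Nodup) (p : List Bool) :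
    weight (p ++ [false]) r + weight (p ++ [true]) r = 2 * weight p r := by
  induction r with
  | nil => simp [weight]
  | cons e r ih =>
    rw [List.map_cons, List.nodup_cons] at hr
    have hw : ∀ p, weight p (e :: r) = entryWeight p e * weight p r := fun p => by simp [weight]
    rw [hw, hw, hw]
    by_cases he : e.1 = p.length
    · rw [weight_append_of_notMem _ (he ▸ hr.1), weight_append_of_notMem _ (he ▸ hr.1), ← add_mul]
      have hp : entryWeight p e = 1 := by simp [entryWeight, he]
      rw [hp, one_mul]
      congr 1
      simp only [entryWeight, he, List.getElem?_concat_length]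
      cases e.2 <;> rfl
    · rw [entryWeight_append_of_ne _ he, entryWeight_append_of_ne _ he, ← mul_add, ih hr.2]
      ring

theorem expected_append_add {R : List (List (ℕ × Bool))} (hR : ∀ r ∈ R, (r.map Prod.fst).Nodup)
    (p : List Bool) : expected R (p ++ [false]) + expected R (p ++ [true]) = 2 * expected R p := by
  rw [expected, expected, expected, ← List.sum_map_add, ← List.sum_map_mul_left]
  refine congrArg List.sum (List.map_congr_left fun r hr => ?_)
  have := congrArg (Nat.cast (R := ℚ)) (weight_append_add (hR r hr) p)
  push_cast at this
  linear_combination (1 / 2) ^ r.length * this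

theorem expected_nonneg (R : List (List (ℕ × Bool))) (p : List Bool) : 0 ≤ expected R p :=
  List.sum_nonneg fun x hx => by
    obtain ⟨r, -, rfl⟩ := List.mem_map.1 hx
    positivity

theorem expected_append (R R' : List (List (ℕ × Bool))) (p : List Bool) :
    expected (R ++ R') p = expected R p + expected R' p := by
  simp [expected]

theorem expected_nil (R : List (List (ℕ × Bool))) :
    expected R [] = (R.map fun r => (1 / 2 : ℚ) ^ r.length).sum := by
  have : ∀ r, weight [] r = 1 := fun r => by
    unfold weight
    exact List.prod_eq_one (by simp [entryWeight])
  simp [expected, this]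

theorem expected_le_two_pow_mul {R : List (List (ℕ × Bool))}
    (hR : ∀ r ∈ R, (r.map Prod.fst).Nodup) (p : List Bool) :
    expected R p ≤ 2 ^ p.length * expected R [] := by
  induction p using List.reverseRecOn with
  | nil => simp
  | append_singleton p b ih =>
    have h := expected_append_add hR p
    have h0 := expected_nonneg R (p ++ [false])
    have h1 := expected_nonneg R (p ++ [true])
    have : expected R (p ++ [b]) ≤ 2 * expected R p := by cases b <;> linarith
    rw [List.length_append, List.length_singleton, pow_succ]
    linarith

/-- The value of the next bit, after the prefix `p`, that does not increase `expected R`. -/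
def nextBit (R : List (List (ℕ × Bool))) (p : List Bool) : Bool :=
  decide (score R (p ++ [true]) < score R (p ++ [false]))

theorem expected_nextBit_le {R : List (List (ℕ × Bool))}
    (hR : ∀ r ∈ R, (r.map Prod.fst).Nodup) (p : List Bool) :
    expected R (p ++ [nextBit R p]) ≤ expected R p := by
  have h := expected_append_add hR p
  have hs : expected R (p ++ [true]) < expected R (p ++ [false]) ↔
      score R (p ++ [true]) < score R (p ++ [false]) := by
    rw [← Nat.cast_lt (α := ℚ), score_eq, score_eq, mul_lt_mul_iff_right₀ (by positivity)]
  by_cases hlt : score R (p ++ [true]) < score R (p ++ [false])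
  · have := hs.2 hlt
    rw [nextBit, decide_eq_true hlt]
    linarith
  · have := not_lt.1 (mt hs.1 hlt)
    rw [nextBit, decide_eq_false hlt]
    linarith

/-- The bits chosen greedily against the events in `R 0, R 1, …`, where `R s` is taken into account
from the position `s` on. -/
def greedyBits (R : ℕ → List (List (ℕ × Bool))) : ℕ → List Bool
  | 0 => []
  | s + 1 => greedyBits R s ++ [nextBit ((List.range (s + 1)).flatMap R) (greedyBits R s)]

theorem length_greedyBits (R : ℕ → List (List (ℕ × Bool))) (s : ℕ) :
    (greedyBits R s).length = s := by
  induction s with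
  | zero => rfl
  | succ s ih => simp [greedyBits, ih]

theorem greedyBits_getElem? (R : ℕ → List (List (ℕ × Bool))) {i s : ℕ} (h : i < s) :
    (greedyBits R s)[i]? = some ((greedyBits R (i + 1)).getD i false) := by
  induction s with
  | zero => omega
  | succ s ih =>
    rcases (Nat.lt_succ_iff_lt_or_eq.1 h) with h' | rfl
    · rw [greedyBits, List.getElem?_append_left (by rwa [length_greedyBits]), ih h']
    · rw [List.getD_eq_getElem?_getD, List.getElem?_eq_getElem (by simp [length_greedyBits])]
      simp

theorem expected_greedyBits_le {R : ℕ → List (List (ℕ × Bool))}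
    (hR : ∀ s, ∀ r ∈ R s, (r.map Prod.fst).Nodup)
    (hsum : ∀ s, ((R s).map fun r => (1 / 2 : ℚ) ^ r.length).sum ≤ (1 / 8) ^ (s + 1)) (s : ℕ) :
    expected ((List.range (s + 1)).flatMap R) (greedyBits R (s + 1)) ≤
      1 / 6 - (1 / 6) * (1 / 4) ^ (s + 1) := by
  have hnd : ∀ r ∈ (List.range (s + 1)).flatMap R, (r.map Prod.fst).Nodup := fun r hr => by
    obtain ⟨k, -, hk⟩ := List.mem_flatMap.1 hr
    exact hR k r hk
  refine (expected_nextBit_le hnd _).trans ?_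
  rw [List.range_succ, List.flatMap_append, List.flatMap_singleton, expected_append]
  have h1 : expected (R s) (greedyBits R s) ≤ (1 / 8) * (1 / 4) ^ s := by
    refine (expected_le_two_pow_mul (hR s) _).trans ?_
    rw [length_greedyBits, expected_nil]
    calc (2 : ℚ) ^ s * _ ≤ 2 ^ s * (1 / 8) ^ (s + 1) := by gcongr; exact hsum s
      _ = _ := by rw [pow_succ, ← mul_assoc, ← mul_pow]; norm_num; ring
  have h2 : expected ((List.range s).flatMap R) (greedyBits R s) ≤
      1 / 6 - (1 / 6) * (1 / 4) ^ s := by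
    cases s with
    | zero => simp [expected]
    | succ s => exact expected_greedyBits_le hR hsum s
  rw [pow_succ]
  linarith

theorem computable_weight : Computable₂ weight := by
  refine Computable.list_prod (Computable.list_map
    (g := fun (a : List Bool × List (ℕ × Bool)) e => entryWeight a.1 e) Computable.snd ?_)
  refine Computable.option_casesOn
    (o := fun q : (List Bool × List (ℕ × Bool)) × ℕ × Bool => q.1.1[q.2.1]?) (f := fun _ => 1)
    (g := fun q b => bif b == q.2.2 then 2 else 0) ?_ (Computable.const 1) ?_
  · exact Computable.list_getElem?.comp (Computable.fst.comp .fst) (Computable.fst.comp .snd)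
  · exact Computable.cond ((Primrec.beq (α := Bool)).to_comp.comp Computable.snd
      (Computable.snd.comp (Computable.snd.comp .fst))) (Computable.const 2) (Computable.const 0)

theorem computable_two_pow : Computable fun n : ℕ => 2 ^ n := by
  refine (Computable.nat_rec (f := fun n : ℕ => n) (g := fun _ => 1)
    (h := fun _ (p : ℕ × ℕ) => 2 * p.2) Computable.id (Computable.const 1) ?_).of_eq fun n => ?_
  · exact (Primrec.nat_mul.to_comp).comp (Computable.const 2) (Computable.snd.comp .snd)
  · induction n with
    | zero => rfl
    | succ n ih => rw [pow_succ, ← ih, Nat.mul_comm]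

theorem computable_score : Computable₂ score := by
  refine Computable.list_sum (Computable.list_map
    (g := fun (a : List (List (ℕ × Bool)) × List Bool) r =>
      weight a.2 r * 2 ^ ((a.1.map List.length).sum - r.length)) Computable.fst ?_)
  refine (Primrec.nat_mul.to_comp).comp (computable_weight.comp (Computable.snd.comp .fst) .snd)
    (computable_two_pow.comp ((Primrec.nat_sub.to_comp).comp ?_
      (Computable.list_length.comp .snd)))
  exact Computable.list_sum (Computable.list_map (Computable.fst.comp .fst)
    (Computable.list_length.comp .snd))

theorem computable_nextBit : Computable₂ nextBit := by
  have h : ∀ b, Computable fun a : List (List (ℕ × Bool)) × List Bool => score a.1 (a.2 ++ [b]) :=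
    fun b => computable_score.comp .fst (Computable.list_append.comp .snd (Computable.const [b]))
  exact (PrimrecRel.decide Primrec.nat_lt).to_comp.comp (h true) (h false)

theorem computable_greedyBits {R : ℕ → List (List (ℕ × Bool))} (hR : Computable R) :
    Computable (greedyBits R) := by
  refine (Computable.nat_rec (f := fun n : ℕ => n) (g := fun _ => [])
    (h := fun _ (p : ℕ × List Bool) =>
      p.2 ++ [nextBit ((List.range (p.1 + 1)).flatMap R) p.2])
    Computable.id (Computable.const []) ?_).of_eq fun n => ?_
  · refine Computable.list_append.comp (Computable.snd.comp .snd)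
      (Computable.list_cons.comp (computable_nextBit.comp ?_ (Computable.snd.comp .snd))
        (Computable.const []))
    exact Computable.list_flatMap (Primrec.list_range.to_comp.comp
      (Computable.succ.comp (Computable.fst.comp .snd))) (hR.comp .snd)
  · induction n with
    | zero => rfl
    | succ n ih => simp only [ih, greedyBits]

/-- An effective union bound: a computable sequence of finite lists of events of quickly decreasing
total probability is avoided by a computable bit sequence. -/
theorem exists_computable_avoiding {R : ℕ → List (List (ℕ × Bool))} (hc : Computable R)
    (hR : ∀ s, ∀ r ∈ R s, (r.map Prod.fst).Nodup)
    (hsum : ∀ s, ((R s).map fun r => (1 / 2 : ℚ) ^ r.length).sum ≤ (1 / 8) ^ (s + 1)) :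
    ∃ T : ℕ → Bool, Computable T ∧ ∀ s, ∀ r ∈ R s, ¬ ∀ e ∈ r, T e.1 = e.2 := by
  refine ⟨fun i => (greedyBits R (i + 1)).getD i false, ?_, fun s r hr hT => ?_⟩
  · exact (Primrec.list_getD false).to_comp.comp
      ((computable_greedyBits hc).comp Computable.succ) Computable.id
  · obtain ⟨t, ht⟩ : ∃ t, ∀ e ∈ r, e.1 < t :=
      ⟨(r.map Prod.fst).sum + 1, fun e he => Nat.lt_succ_of_le
        (List.single_le_sum (fun _ _ => Nat.zero_le _) _ (List.mem_map_of_mem he))⟩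
    have hle := expected_greedyBits_le hR hsum (s + t)
    have hw : weight (greedyBits R (s + t + 1)) r = 2 ^ r.length := by
      rw [weight, List.map_congr_left (g := fun _ => 2) fun e he => ?_]
      · simp
      · rw [entryWeight, greedyBits_getElem? R (by have := ht e he; omega), ← hT e he]
        simp
    have hmem : r ∈ (List.range (s + t + 1)).flatMap R :=
      List.mem_flatMap.2 ⟨s, List.mem_range.2 (by omega), hr⟩
    have hone : (1 : ℚ) ≤ expected ((List.range (s + t + 1)).flatMap R)
        (greedyBits R (s + t + 1)) := by
      refine le_trans (le_of_eq ?_) (List.single_le_sum (fun x hx => ?_) _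
        (List.mem_map_of_mem (f := fun r => (weight (greedyBits R (s + t + 1)) r : ℚ) *
          (1 / 2) ^ r.length) hmem))
      · rw [hw]; push_cast; rw [← mul_pow]; norm_num
      · obtain ⟨r, -, rfl⟩ := List.mem_map.1 hx
        positivity
    have : (0 : ℚ) < (1 / 4) ^ (s + t + 1) := by positivity
    linarith

end PartialEvent

namespace ResampleLog

variable (vs : ℕ → List (ℕ × Bool)) (T : ℕ → Bool)

/-- The variables of the clause with index `j`. -/
def vars (j : ℕ) : List ℕ := (vs j).map Prod.fst

/-- The number of times the variable `v` has been resampled in the log `L`. -/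
def cnt (L : List ℕ) (v : ℕ) : ℕ := (L.flatMap (vars vs)).count v

/-- The total number of single-variable resamplings in the log `L`. -/
def size (L : List ℕ) : ℕ := (L.flatMap (vars vs)).length

/-- Whether the clause `j` is violated after the log `L`, where the successive values of the
variable `v` are `T (Nat.pair v 0), T (Nat.pair v 1), …`. -/
def viol (L : List ℕ) (j : ℕ) : Bool :=
  (vs j).all fun e => T (Nat.pair e.1 (cnt vs L e.1)) == !e.2

/-- A log, with the latest entry first, is legal if each clause was violated when resampled. -/
def Legal : List ℕ → Prop
  | [] => True
  | B :: L => viol vs T L B = true ∧ Legal L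

/-- The entries of the log `L` on which the later variables in `X` depend. -/
noncomputable def pyr : Set ℕ → List ℕ → List ℕ
  | _, [] => []
  | X, B :: L => open Classical in
    if ∃ v ∈ vars vs B, v ∈ X then B :: pyr (X ∪ {v | v ∈ vars vs B}) L else pyr X L

/-- The entries of the log `L` on which the later variables in `X` do not depend. -/
noncomputable def rest : Set ℕ → List ℕ → List ℕ
  | _, [] => []
  | X, B :: L => open Classical in
    if ∃ v ∈ vars vs B, v ∈ X then rest (X ∪ {v | v ∈ vars vs B}) L else B :: rest X L

/-- All entries of the log influence the later variables in `X`. -/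
def Conn : Set ℕ → List ℕ → Prop
  | _, [] => True
  | X, B :: L => (∃ v ∈ vars vs B, v ∈ X) ∧ Conn (X ∪ {v | v ∈ vars vs B}) L

variable {vs T}

theorem cnt_append (L L' : List ℕ) (v : ℕ) : cnt vs (L ++ L') v = cnt vs L v + cnt vs L' v := by
  simp [cnt]

theorem cnt_cons (B : ℕ) (L : List ℕ) (v : ℕ) :
    cnt vs (B :: L) v = (vars vs B).count v + cnt vs L v := by
  simp [cnt]

theorem cnt_perm {L L' : List ℕ} (h : L.Perm L') : cnt vs L = cnt vs L' :=
  funext fun v => (h.flatMap_right _).count_eq v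

theorem size_perm {L L' : List ℕ} (h : L.Perm L') : size vs L = size vs L' :=
  (h.flatMap_right _).length_eq

theorem size_cons (B : ℕ) (L : List ℕ) : size vs (B :: L) = (vs B).length + size vs L := by
  simp [size, vars]

theorem size_append (L L' : List ℕ) : size vs (L ++ L') = size vs L + size vs L' := by
  simp [size]

theorem viol_congr {L L' : List ℕ} {j : ℕ} (h : ∀ v ∈ vars vs j, cnt vs L v = cnt vs L' v) :
    viol vs T L j = viol vs T L' j := by
  rw [viol, viol, Bool.eq_iff_iff, List.all_eq_true, List.all_eq_true]
  refine forall₂_congr fun e he => ?_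
  rw [h e.1 (List.mem_map_of_mem he)]

theorem Legal.of_append {L L' : List ℕ} (h : Legal vs T (L ++ L')) : Legal vs T L' := by
  induction L with
  | nil => exact h
  | cons B L ih => exact ih h.2

theorem Legal.replace {L Y Y' : List ℕ} (h : Legal vs T (L ++ Y)) (hY : Legal vs T Y')
    (hc : cnt vs Y = cnt vs Y') : Legal vs T (L ++ Y') := by
  induction L with
  | nil => exact hY
  | cons B L ih =>
    have h1 : viol vs T (L ++ Y) B = true := h.1
    refine ⟨?_, ih h.2⟩
    change viol vs T (L ++ Y') B = true
    rw [← h1]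
    exact viol_congr fun v _ => by rw [cnt_append, cnt_append, hc]

theorem Legal.insert {R P : List ℕ} {B : ℕ}
    (hd : ∀ C ∈ R, ∀ v ∈ vars vs C, v ∉ vars vs B) (h : Legal vs T (R ++ P))
    (hB : viol vs T (R ++ P) B = true) : Legal vs T (R ++ B :: P) := by
  induction R with
  | nil => exact ⟨hB, h⟩
  | cons C R ih =>
    have hC := hd C List.mem_cons_self
    have h1 : viol vs T (R ++ P) C = true := h.1
    refine ⟨?_, ih (fun D hD => hd D (List.mem_cons_of_mem _ hD)) h.2 ?_⟩
    · change viol vs T (R ++ B :: P) C = true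
      rw [← h1]
      refine viol_congr fun v hv => ?_
      rw [cnt_append, cnt_append, cnt_cons, List.count_eq_zero_of_not_mem (hC v hv), zero_add]
    · rw [← hB]
      refine viol_congr fun v hv => ?_
      rw [List.cons_append, cnt_cons, List.count_eq_zero_of_not_mem fun h' => hC v h' hv, zero_add]

theorem rest_append_pyr_perm (X : Set ℕ) (L : List ℕ) :
    (rest vs X L ++ pyr vs X L).Perm L := by
  induction L generalizing X with
  | nil => simp [rest, pyr]
  | cons B L ih =>
    by_cases hB : ∃ v ∈ vars vs B, v ∈ X
    · rw [rest, pyr, if_pos hB, if_pos hB]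
      exact List.perm_middle.trans ((ih _).cons _)
    · rw [rest, pyr, if_neg hB, if_neg hB]
      exact (ih _).cons _

theorem notMem_of_mem_rest {X : Set ℕ} {L : List ℕ} {C : ℕ} (hC : C ∈ rest vs X L) :
    ∀ v ∈ vars vs C, v ∉ X := by
  induction L generalizing X with
  | nil => simp [rest] at hC
  | cons B L ih =>
    by_cases hB : ∃ v ∈ vars vs B, v ∈ X
    · rw [rest, if_pos hB] at hC
      exact fun v hv hX => ih hC v hv (Or.inl hX)
    · rw [rest, if_neg hB] at hC
      rcases List.mem_cons.1 hC with rfl | hC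
      · exact fun v hv hX => hB ⟨v, hv, hX⟩
      · exact ih hC

theorem Legal.split {L acc : List ℕ} (h : Legal vs T (L ++ acc)) (X : Set ℕ) :
    Legal vs T (rest vs X L ++ (pyr vs X L ++ acc)) := by
  induction L generalizing X with
  | nil => simpa [rest, pyr] using h
  | cons B L ih =>
    have hv : ∀ X, viol vs T (rest vs X L ++ (pyr vs X L ++ acc)) B = true := fun X => by
      have h1 : viol vs T (L ++ acc) B = true := h.1
      rw [← h1, ← List.append_assoc]
      exact viol_congr fun v _ => by rw [cnt_perm ((rest_append_pyr_perm X L).append_right acc)]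
    by_cases hB : ∃ v ∈ vars vs B, v ∈ X
    · rw [rest, pyr, if_pos hB, if_pos hB]
      exact Legal.insert (fun C hC v hvC hvB => notMem_of_mem_rest hC v hvC (Or.inr hvB))
        (ih h.2 _) (hv _)
    · rw [rest, pyr, if_neg hB, if_neg hB]
      exact ⟨hv _, ih h.2 _⟩

theorem Legal.pyr {L : List ℕ} (h : Legal vs T L) (X : Set ℕ) : Legal vs T (pyr vs X L) := by
  have := (Legal.split (acc := []) (by simpa using h) X).of_append
  simpa using this

theorem conn_pyr (X : Set ℕ) (L : List ℕ) : Conn vs X (pyr vs X L) := by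
  induction L generalizing X with
  | nil => simp [pyr, Conn]
  | cons B L ih =>
    by_cases hB : ∃ v ∈ vars vs B, v ∈ X
    · rw [pyr, if_pos hB]
      exact ⟨hB, ih _⟩
    · rw [pyr, if_neg hB]
      exact ih _

theorem Conn.rest {X Y : Set ℕ} {L : List ℕ} (h : Conn vs (X ∪ Y) L) :
    Conn vs Y (rest vs X L) := by
  induction L generalizing X Y with
  | nil => simp [ResampleLog.rest, Conn]
  | cons B L ih =>
    by_cases hB : ∃ v ∈ vars vs B, v ∈ X
    · rw [ResampleLog.rest, if_pos hB]
      refine ih ?_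
      rw [Set.union_right_comm]
      exact h.2
    · rw [ResampleLog.rest, if_neg hB]
      refine ⟨?_, ih ?_⟩
      · obtain ⟨v, hv, hX | hY⟩ := h.1
        · exact absurd ⟨v, hv, hX⟩ hB
        · exact ⟨v, hv, hY⟩
      · rw [← Set.union_assoc]
        exact h.2

theorem pyr_append (X : Set ℕ) (E L : List ℕ) :
    pyr vs X (E ++ L) =
      pyr vs X E ++ pyr vs (X ∪ {v | ∃ C ∈ pyr vs X E, v ∈ vars vs C}) L := by
  induction E generalizing X with
  | nil => simp [pyr]
  | cons B E ih =>
    by_cases hB : ∃ v ∈ vars vs B, v ∈ X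
    · rw [List.cons_append, pyr, pyr, if_pos hB, if_pos hB, ih, List.cons_append]
      congr 3
      ext v
      simp [or_assoc]
    · rw [List.cons_append, pyr, pyr, if_neg hB, if_neg hB, ih]

theorem cnt_pyr {X : Set ℕ} (L : List ℕ) {v : ℕ} (hv : v ∈ X) :
    cnt vs (pyr vs X L) v = cnt vs L v := by
  have h := congrFun (cnt_perm (vs := vs) (rest_append_pyr_perm (vs := vs) X L)) v
  rw [cnt_append] at h
  have h0 : cnt vs (rest vs X L) v = 0 := by
    refine List.count_eq_zero_of_not_mem fun hm => ?_
    obtain ⟨C, hC, hvC⟩ := List.mem_flatMap.1 hm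
    exact notMem_of_mem_rest hC v hvC hv
  omega

section Resampling

variable (vs T)

/-- Resample the first violated clause with index below `t`, if there is one. -/
def fire (L : List ℕ) (t : ℕ) : List ℕ :=
  Option.casesOn ((List.range t).find? (viol vs T L)) L fun j => j :: L

/-- The log of the resampling process after `t` steps. -/
def proc : ℕ → List ℕ
  | 0 => []
  | t + 1 => fire vs T (proc t) t

variable {vs T}

theorem legal_proc (t : ℕ) : Legal vs T (proc vs T t) := by
  induction t with
  | zero => trivial
  | succ t ih =>
    rw [proc, fire]
    rcases h : (List.range t).find? (viol vs T (proc vs T t)) with _ | j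
    · exact ih
    · exact ⟨List.find?_some h, ih⟩

theorem exists_proc_eq_append {t t' : ℕ} (h : t ≤ t') :
    ∃ E, proc vs T t' = E ++ proc vs T t := by
  induction t', h using Nat.le_induction with
  | base => exact ⟨[], rfl⟩
  | succ t' _ ih =>
    obtain ⟨E, hE⟩ := ih
    rw [proc, fire]
    rcases (List.range t').find? (viol vs T (proc vs T t')) with _ | j
    · exact ⟨E, hE⟩
    · exact ⟨j :: E, by simp [hE]⟩

theorem cnt_lt_of_legal {bnd : ℕ → ℕ}
    (hb : ∀ n L, Legal vs T L → Conn vs {n} L → size vs L < bnd n) {L : List ℕ}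
    (hL : Legal vs T L) (n : ℕ) : cnt vs L n < bnd n := by
  rw [← cnt_pyr L (Set.mem_singleton n)]
  exact List.count_le_length.trans_lt (hb n _ (hL.pyr _) (conn_pyr _ _))

theorem exists_viol_proc_eq_false {bnd : ℕ → ℕ} (hne : ∀ j, vs j ≠ [])
    (hb : ∀ n L, Legal vs T L → Conn vs {n} L → size vs L < bnd n) (J t₀ : ℕ) :
    ∃ t, t₀ ≤ t ∧ ∀ j < J, viol vs T (proc vs T t) j = false := by
  by_contra! hcon
  obtain ⟨V, hV⟩ : ∃ V, ∀ j < J, ∀ v ∈ vars vs j, v < V :=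
    ⟨((List.range J).flatMap (vars vs)).sum + 1, fun j hj v hv => Nat.lt_succ_of_le
      (List.single_le_sum (fun _ _ => Nat.zero_le _) _
        (List.mem_flatMap.2 ⟨j, List.mem_range.2 hj, hv⟩))⟩
  have hgrow : ∀ d, d ≤ ∑ v ∈ Finset.range V, cnt vs (proc vs T (t₀ + J + d)) v := by
    intro d
    induction d with
    | zero => exact Nat.zero_le _
    | succ d ih =>
      refine Nat.succ_le_of_lt (ih.trans_lt ?_)
      rw [← Nat.add_assoc, proc, fire]
      obtain ⟨j, hj, hjv⟩ := hcon (t₀ + J + d) (by omega)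
      have hjv : viol vs T (proc vs T (t₀ + J + d)) j = true := by simpa using hjv
      rcases hf : (List.range (t₀ + J + d)).find? (viol vs T (proc vs T (t₀ + J + d))) with _ | i
      · rw [List.find?_eq_none] at hf
        exact absurd hjv (hf j (List.mem_range.2 (by omega)))
      · have hi : i < J := by
          rw [List.find?_range_eq_some] at hf
          by_contra hi
          have := hf.2.2 j (by omega)
          simp [hjv] at this
        obtain ⟨e, he⟩ := List.exists_mem_of_ne_nil _ (hne i)
        have hev : e.1 ∈ vars vs i := List.mem_map_of_mem he
        refine Finset.sum_lt_sum (fun v _ => ?_) ⟨e.1, Finset.mem_range.2 (hV i hi _ hev), ?_⟩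
        · rw [cnt_cons]; omega
        · rw [cnt_cons]
          have := List.count_pos_iff.2 hev
          omega
  have h := hgrow (∑ v ∈ Finset.range V, bnd v + 1)
  have h' : ∑ v ∈ Finset.range V,
      cnt vs (proc vs T (t₀ + J + (∑ v ∈ Finset.range V, bnd v + 1))) v ≤
      ∑ v ∈ Finset.range V, bnd v :=
    Finset.sum_le_sum fun v _ => (cnt_lt_of_legal hb (legal_proc _) v).le
  omega

theorem cnt_append_eq_of_legal {F : ℕ → List ℕ}
    (hF : ∀ n L, Legal vs T L → Conn vs {n} L → ∀ j ∈ L, j ∈ F n) {n : ℕ} {E L : List ℕ}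
    (hL : ∀ j ∈ F n, viol vs T L j = false) (h : Legal vs T (E ++ L)) :
    cnt vs (E ++ L) n = cnt vs L n := by
  have hpyr := pyr_append (vs := vs) {n} E L
  have hleg := h.pyr {n}
  have hconn := conn_pyr (vs := vs) {n} (E ++ L)
  have hmem := hF n _ hleg hconn
  rw [hpyr] at hleg hmem
  rcases List.eq_nil_or_concat (pyr vs {n} E) with hP | ⟨P, B, hP⟩
  · rw [cnt_append, ← cnt_pyr E (Set.mem_singleton n), hP]
    simp [cnt]
  · exfalso
    have hBmem : B ∈ pyr vs {n} E := by simp [hP]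
    have hB := hL B (hmem B (List.mem_append_left _ hBmem))
    rw [hP, List.concat_eq_append, List.append_assoc] at hleg
    have hviol : viol vs T (pyr vs _ L) B = true := hleg.of_append.1
    rw [viol_congr (L' := L)] at hviol
    · simp [hB] at hviol
    · intro v hv
      exact cnt_pyr L (Or.inr ⟨B, by simp, hv⟩)

theorem exists_coloring {bnd : ℕ → ℕ} {F : ℕ → List ℕ} (hne : ∀ j, vs j ≠ [])
    (hb : ∀ n L, Legal vs T L → Conn vs {n} L → size vs L < bnd n)
    (hF : ∀ n L, Legal vs T L → Conn vs {n} L → ∀ j ∈ L, j ∈ F n) :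
    ∃ h : ∀ n, ∃ t, ((F n).all fun j => !viol vs T (proc vs T t) j) = true,
      ∀ j, ∃ e ∈ vs j, T (Nat.pair e.1 (cnt vs (proc vs T (Nat.find (h e.1))) e.1)) = e.2 := by
  refine ⟨fun n => ?_, fun j => ?_⟩
  · obtain ⟨t, -, ht⟩ := exists_viol_proc_eq_false hne hb ((F n).sum + 1) 0
    refine ⟨t, List.all_eq_true.2 fun j hj => ?_⟩
    rw [ht j (Nat.lt_succ_of_le (List.single_le_sum (fun _ _ => Nat.zero_le _) _ hj))]
    rfl
  · generalize_proofs h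
    obtain ⟨t, ht, hj⟩ := exists_viol_proc_eq_false hne hb (j + 1)
      (((vars vs j).map fun n : ℕ => Nat.find (h n)).sum)
    have hj := hj j (Nat.lt_succ_self j)
    rw [viol, List.all_eq_false] at hj
    obtain ⟨e, he, hne⟩ := hj
    refine ⟨e, he, ?_⟩
    have hle : Nat.find (h e.1) ≤ t := le_trans
      (List.single_le_sum (fun _ _ => Nat.zero_le _) _ (List.mem_map_of_mem
        (f := fun n : ℕ => Nat.find (h n)) (show e.1 ∈ vars vs j from List.mem_map_of_mem he))) ht
    obtain ⟨E, hE⟩ := exists_proc_eq_append (vs := vs) (T := T) hle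
    have hleg := legal_proc (vs := vs) (T := T) t
    have hspec := List.all_eq_true.1 (Nat.find_spec (h e.1))
    rw [hE] at hleg
    rw [hE, cnt_append_eq_of_legal hF (fun i hi => by simpa using hspec i hi) hleg] at hne
    simpa using hne

end Resampling

section Generation

variable (vs) (cl : ℕ → List ℕ)

/-- One step of the nondeterministic generation of logs. A state consists of the part of the log
that has been generated and of a stack of tasks: `(false, u)` asks to generate entries influencing
the variable `u`, where `cl u` lists the clauses containing `u`, and `(true, A)` asks to append the
entry `A`. -/
def step : List ℕ × List (Bool × ℕ) → List (List ℕ × List (Bool × ℕ))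
  | (acc, []) => [(acc, [])]
  | (acc, (false, u) :: stk) => (acc, stk) ::
      (cl u).map fun A => (acc, (vars vs A).map (Prod.mk false) ++ (true, A) :: stk)
  | (acc, (true, A) :: stk) => [(A :: acc, stk)]

/-- The states reachable from `s` in `k` steps. -/
def run (k : ℕ) (s : List ℕ × List (Bool × ℕ)) : List (List ℕ × List (Bool × ℕ)) :=
  Nat.rec [s] (fun _ l => l.flatMap (step vs cl)) k

variable {vs cl}

theorem mem_run_succ {k : ℕ} {s₀ s s' : List ℕ × List (Bool × ℕ)} (h : s ∈ run vs cl k s₀)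
    (h' : s' ∈ step vs cl s) : s' ∈ run vs cl (k + 1) s₀ :=
  List.mem_flatMap.2 ⟨s, h, h'⟩

theorem mem_run_of_le {k k' : ℕ} {s₀ : List ℕ × List (Bool × ℕ)} {acc : List ℕ}
    (h : (acc, []) ∈ run vs cl k s₀) (hk : k ≤ k') : (acc, []) ∈ run vs cl k' s₀ := by
  induction k', hk using Nat.le_induction with
  | base => exact h
  | succ k' _ ih => exact mem_run_succ ih (by simp [step])

theorem exists_mem_run {s₀ : List ℕ × List (Bool × ℕ)} (L us acc : List ℕ)
    (stk : List (Bool × ℕ)) (k : ℕ) (hcl : ∀ A ∈ L, ∀ u ∈ vars vs A, A ∈ cl u)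
    (hconn : Conn vs {v | v ∈ us} L) (hleg : Legal vs T (L ++ acc))
    (hk : (acc, us.map (Prod.mk false) ++ stk) ∈ run vs cl k s₀) :
    ∃ acc', Legal vs T acc' ∧ acc'.Perm (L ++ acc) ∧
      (acc', stk) ∈ run vs cl (k + us.length + size vs L + L.length) s₀ := by
  match us with
  | [] =>
    obtain rfl : L = [] := by
      cases L with
      | nil => rfl
      | cons B L => obtain ⟨⟨v, _, hv⟩, _⟩ := hconn; simp at hv
    exact ⟨acc, hleg, List.Perm.refl _, by simpa [size] using hk⟩
  | u :: us =>
    have hperm := rest_append_pyr_perm (vs := vs) {u} L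
    have hsize := size_perm (vs := vs) hperm
    have hlen := hperm.length_eq
    have hR : Conn vs {v | v ∈ us} (rest vs {u} L) := Conn.rest (X := {u}) (by
      convert hconn using 1; ext v; simp)
    have hsplit := hleg.split {u}
    have hclR : ∀ A ∈ rest vs {u} L, ∀ u ∈ vars vs A, A ∈ cl u := fun A hA =>
      hcl A (hperm.subset (List.mem_append_left _ hA))
    have hclP : ∀ A ∈ pyr vs {u} L, ∀ u ∈ vars vs A, A ∈ cl u := fun A hA =>
      hcl A (hperm.subset (List.mem_append_right _ hA))
    have hP := conn_pyr (vs := vs) {u} L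
    rw [size_append] at hsize
    rw [List.length_append] at hlen
    match hPeq : pyr vs {u} L with
    | [] =>
      rw [hPeq] at hsplit hsize hlen hperm
      have hRL : (rest vs {u} L).length ≤ L.length := by omega
      obtain ⟨acc', h1, h2, h3⟩ := exists_mem_run (rest vs {u} L) us acc stk (k + 1) hclR hR
        hsplit (mem_run_succ hk (by simp [step]))
      refine ⟨acc', h1, h2.trans (List.Perm.append_right _ (by simpa using hperm)), ?_⟩
      convert h3 using 2
      simp only [size, List.flatMap_nil, List.length_nil, List.length_cons] at hsize hlen ⊢
      omega
    | A :: P =>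
      rw [hPeq] at hsplit hsize hlen hperm hP hclP
      obtain ⟨⟨v, hvA, rfl⟩, hP⟩ := hP
      rw [size_cons] at hsize
      rw [List.length_cons] at hlen
      have hPL : P.length < L.length := by omega
      have hRL : (rest vs {v} L).length < L.length := by omega
      have hlegP := hsplit.of_append
      obtain ⟨acc₁, h1, h2, h3⟩ := exists_mem_run P (vars vs A) acc
        ((true, A) :: (us.map (Prod.mk false) ++ stk)) (k + 1)
        (fun B hB => hclP B (List.mem_cons_of_mem _ hB))
        (by convert hP using 1; ext w; simp; rintro rfl; exact hvA) hlegP.2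
        (mem_run_succ hk (by
          simp only [List.map_cons, List.cons_append, step]
          exact List.mem_cons_of_mem _ (List.mem_map.2
            ⟨A, hclP A List.mem_cons_self v hvA, rfl⟩)))
      have hA : viol vs T (P ++ acc) A = true := hlegP.1
      rw [← viol_congr fun v _ => congrFun (cnt_perm h2) v] at hA
      obtain ⟨acc', h4, h5, h6⟩ := exists_mem_run (rest vs {v} L) us (A :: acc₁) stk _ hclR hR
        (hsplit.replace (Y' := A :: acc₁) ⟨hA, h1⟩ (cnt_perm (h2.symm.cons A)))
        (mem_run_succ h3 (by simp [step]))
      refine ⟨acc', h4, h5.trans (((h2.cons A).append_left _).trans ?_), ?_⟩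
      · have := hperm.append_right acc
        simpa using this
      · convert h6 using 2
        have : (vars vs A).length = (vs A).length := by simp [vars]
        rw [List.length_cons]
        omega
termination_by (L.length, us.length)
decreasing_by
  all_goals simp only [Prod.lex_def, List.length_cons]; omega

section Weight

variable {z y : ℝ}

variable (vs z y) in
/-- The total weight of the tasks on a stack. -/
noncomputable def taskWeight (stk : List (Bool × ℕ)) : ℝ :=
  (stk.map fun x => bif x.1 then z ^ (vs x.2).length else y).prod

theorem taskWeight_nonneg (hz : 0 ≤ z) (hy : 0 ≤ y) (stk : List (Bool × ℕ)) :
    0 ≤ taskWeight vs z y stk := by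
  refine List.prod_nonneg fun x hx => ?_
  obtain ⟨⟨_ | _, i⟩, -, rfl⟩ := List.mem_map.1 hx
  · exact hy
  · exact pow_nonneg hz _

theorem sum_step_le (hz : 0 ≤ z) (hy : 0 ≤ y)
    (h : ∀ u, 1 + ((cl u).map fun A => (z * y) ^ (vs A).length).sum ≤ y)
    (s : List ℕ × List (Bool × ℕ)) :
    ((step vs cl s).map fun s => z ^ size vs s.1 * taskWeight vs z y s.2).sum ≤
      z ^ size vs s.1 * taskWeight vs z y s.2 := by
  match s with
  | (acc, []) => simp [step]
  | (acc, (true, A) :: stk) =>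
    simp only [step, taskWeight, List.map_cons, List.map_nil, List.sum_cons, List.sum_nil,
      List.prod_cons, size_cons, cond_true, pow_add]
    exact le_of_eq (by ring)
  | (acc, (false, u) :: stk) =>
    have h0 : 0 ≤ z ^ size vs acc * taskWeight vs z y stk :=
      mul_nonneg (pow_nonneg hz _) (taskWeight_nonneg hz hy stk)
    have hA : ∀ A, z ^ size vs acc *
        taskWeight vs z y ((vars vs A).map (Prod.mk false) ++ (true, A) :: stk) =
        z ^ size vs acc * taskWeight vs z y stk * (z * y) ^ (vs A).length := fun A => by
      simp [taskWeight, vars, Function.comp_def, mul_pow]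
      ring
    simp only [step, List.map_cons, List.sum_cons, List.map_map, Function.comp_def, hA,
      List.sum_map_mul_left]
    calc _ = z ^ size vs acc * taskWeight vs z y stk *
          (1 + ((cl u).map fun A => (z * y) ^ (vs A).length).sum) := by ring
      _ ≤ z ^ size vs acc * taskWeight vs z y stk * y := mul_le_mul_of_nonneg_left (h u) h0
      _ = _ := by simp [taskWeight]; ring

theorem sum_run_le (hz : 0 ≤ z) (hy : 0 ≤ y)
    (h : ∀ u, 1 + ((cl u).map fun A => (z * y) ^ (vs A).length).sum ≤ y) (k : ℕ)
    (s : List ℕ × List (Bool × ℕ)) :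
    ((run vs cl k s).map fun s => z ^ size vs s.1 * taskWeight vs z y s.2).sum ≤
      z ^ size vs s.1 * taskWeight vs z y s.2 := by
  induction k with
  | zero => simp [run]
  | succ k ih =>
    refine le_trans ?_ ih
    change (((run vs cl k s).flatMap (step vs cl)).map _).sum ≤ _
    induction run vs cl k s with
    | nil => simp
    | cons t l ih' =>
      rw [List.flatMap_cons, List.map_append, List.sum_append, List.map_cons, List.sum_cons]
      exact add_le_add (sum_step_le hz hy h t) ih'

variable (vs) in
/-- The values of the bits `T` that make the log legal. -/
def req : List ℕ → List (ℕ × Bool)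
  | [] => []
  | B :: L => (vs B).map (fun e => (Nat.pair e.1 (cnt vs L e.1), !e.2)) ++ req L

theorem length_req (L : List ℕ) : (req vs L).length = size vs L := by
  induction L with
  | nil => rfl
  | cons B L ih => rw [req, List.length_append, List.length_map, ih, size_cons]

theorem legal_iff {L : List ℕ} : Legal vs T L ↔ ∀ e ∈ req vs L, T e.1 = e.2 := by
  induction L with
  | nil => simp [Legal, req]
  | cons B L ih => simp [Legal, req, ih, viol, or_imp, forall_and]

theorem lt_cnt_of_mem_req {L : List ℕ} {e : ℕ × Bool} (he : e ∈ req vs L) :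
    e.1.unpair.2 < cnt vs L e.1.unpair.1 := by
  induction L with
  | nil => simp [req] at he
  | cons B L ih =>
    rw [cnt_cons]
    rcases List.mem_append.1 he with he | he
    · obtain ⟨d, hd, rfl⟩ := List.mem_map.1 he
      have : 0 < (vars vs B).count d.1 := List.count_pos_iff.2 (List.mem_map_of_mem hd)
      simpa using this
    · exact (ih he).trans_le (Nat.le_add_left _ _)

theorem nodup_req (hvs : ∀ j, (vars vs j).Nodup) (L : List ℕ) :
    ((req vs L).map Prod.fst).Nodup := by
  induction L with
  | nil => simp [req]
  | cons B L ih =>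
    rw [req, List.map_append, List.nodup_append, List.map_map]
    refine ⟨?_, ih, ?_⟩
    · refine (List.Nodup.of_map (f := fun k : ℕ => k.unpair.1) ?_)
      rw [List.map_map]
      simpa [Function.comp_def] using show ((vs B).map fun e => e.1).Nodup from hvs B
    · rintro _ h₁ _ h₂ rfl
      obtain ⟨d, -, hd⟩ := List.mem_map.1 h₁
      obtain ⟨e, he, hde⟩ := List.mem_map.1 h₂
      have := lt_cnt_of_mem_req he
      rw [hde, ← hd] at this
      simp at this

variable (vs cl) in
/-- The requirements of the generated logs of size at least `S` whose entries all influence the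
variable `n`. -/
def reqs (b S n : ℕ) : List (List (ℕ × Bool)) :=
  (run vs cl (2 * b + 1) ([], [(false, n)])).flatMap fun s =>
    bif s.2.length == 0 && decide (S ≤ size vs s.1) then [req vs s.1] else []

theorem sum_reqs_le (hz : 1 / 2 ≤ z) (hy : 0 ≤ y)
    (h : ∀ u, 1 + ((cl u).map fun A => (z * y) ^ (vs A).length).sum ≤ y) (b S n : ℕ) :
    ((reqs vs cl b S n).map fun r => (1 / 2 : ℝ) ^ r.length).sum ≤ (1 / (2 * z)) ^ S * y := by
  have hz0 : 0 < z := by linarith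
  have hc : 0 ≤ (1 / (2 * z)) ^ S := by positivity
  have key : ∀ l : List (List ℕ × List (Bool × ℕ)),
      ((l.flatMap fun s => bif s.2.length == 0 && decide (S ≤ size vs s.1) then [req vs s.1]
        else []).map fun r => (1 / 2 : ℝ) ^ r.length).sum ≤
      (1 / (2 * z)) ^ S * (l.map fun s => z ^ size vs s.1 * taskWeight vs z y s.2).sum := by
    intro l
    induction l with
    | nil => simp
    | cons s l ih =>
      rw [List.flatMap_cons, List.map_append, List.sum_append, List.map_cons, List.sum_cons,
        mul_add]
      refine add_le_add ?_ ih
      have hs := taskWeight_nonneg (vs := vs) hz0.le hy s.2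
      rcases hb : (s.2.length == 0 && decide (S ≤ size vs s.1)) with _ | _
      · simp only [cond_false, List.map_nil, List.sum_nil]
        positivity
      · simp only [Bool.and_eq_true, beq_iff_eq, List.length_eq_zero_iff, decide_eq_true_eq] at hb
        rw [hb.1]
        simp only [cond_true, List.map_cons, List.map_nil, List.sum_cons, List.sum_nil, add_zero,
          length_req, taskWeight, List.prod_nil, mul_one]
        calc (1 / 2 : ℝ) ^ size vs s.1 = (1 / (2 * z)) ^ size vs s.1 * z ^ size vs s.1 := by
              rw [← mul_pow]; congr 1; field_simp
          _ ≤ _ := by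
              refine mul_le_mul_of_nonneg_right ?_ (by positivity)
              refine pow_le_pow_of_le_one (by positivity) ?_ hb.2
              rw [div_le_one (by positivity)]
              linarith
  refine (key _).trans (mul_le_mul_of_nonneg_left ?_ hc)
  refine (sum_run_le hz0.le hy h _ _).trans (le_of_eq ?_)
  simp [size, taskWeight]

end Weight

/-- Every legal log of size at most `b` whose entries all influence `n` is generated, up to a
permutation preserving legality. -/
theorem exists_mem_run_of_size_le (hne : ∀ j, vs j ≠ []) {b n : ℕ} {L : List ℕ}
    (hcl : ∀ A, (vs A).length ≤ b → ∀ u ∈ vars vs A, A ∈ cl u)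
    (hL : Legal vs T L) (hconn : Conn vs {n} L) (hb : size vs L ≤ b) :
    ∃ L', Legal vs T L' ∧ L'.Perm L ∧ (L', []) ∈ run vs cl (2 * b + 1) ([], [(false, n)]) := by
  have hmem : ∀ A ∈ L, (vs A).length ≤ size vs L := fun A hA => by
    rw [size, List.length_flatMap]
    refine List.single_le_sum (fun _ _ => Nat.zero_le _) _ (List.mem_map.2 ⟨A, hA, ?_⟩)
    simp [vars]
  have hlen : L.length ≤ size vs L := by
    clear hb hmem hconn hL
    induction L with
    | nil => simp
    | cons B L ih =>
      have := List.length_pos_of_ne_nil (hne B)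
      rw [size_cons, List.length_cons]
      omega
  obtain ⟨L', h1, h2, h3⟩ := exists_mem_run (s₀ := ([], [(false, n)])) (T := T) L [n] [] [] 0
    (fun A hA => hcl A ((hmem A hA).trans hb)) (by convert hconn using 1; ext; simp)
    (by simpa using hL) (by simp [run])
  refine ⟨L', h1, by simpa using h2, mem_run_of_le h3 ?_⟩
  simp only [List.length_singleton]
  omega

end Generation

section Computability

theorem computable_vars (hvs : Computable vs) : Computable (vars vs) :=
  Computable.list_map hvs (Computable.fst.comp .snd)

theorem computable_cnt (hvs : Computable vs) : Computable₂ (cnt vs) :=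
  Computable.list_count (Computable.list_flatMap Computable.fst
    ((computable_vars hvs).comp .snd)) Computable.snd

theorem computable_size (hvs : Computable vs) : Computable (size vs) :=
  Computable.list_length.comp (Computable.list_flatMap Computable.id
    ((computable_vars hvs).comp .snd))

theorem computable_pair_cnt (hvs : Computable vs) :
    Computable₂ fun (L : List ℕ) (v : ℕ) => Nat.pair v (cnt vs L v) :=
  (Primrec₂.natPair.to_comp).comp Computable.snd (computable_cnt hvs)

theorem computable_viol (hvs : Computable vs) (hT : Computable T) : Computable₂ (viol vs T) := by
  refine Computable.list_all (hvs.comp .snd) ((Primrec.beq (α := Bool)).to_comp.comp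
    (hT.comp ((computable_pair_cnt hvs).comp (Computable.fst.comp .fst)
      (Computable.fst.comp .snd))) (Primrec.not.to_comp.comp (Computable.snd.comp .snd)))

theorem computable_proc (hvs : Computable vs) (hT : Computable T) : Computable (proc vs T) := by
  refine (Computable.nat_rec (f := fun n : ℕ => n) (g := fun _ => [])
    (h := fun _ (p : ℕ × List ℕ) => fire vs T p.2 p.1)
    Computable.id (Computable.const []) ?_).of_eq fun n => ?_
  · refine Computable.option_casesOn
      (o := fun q : ℕ × ℕ × List ℕ => (List.range q.2.1).find? (viol vs T q.2.2))
      (f := fun q => q.2.2) (g := fun q j => j :: q.2.2) ?_ (Computable.snd.comp .snd) ?_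
    · exact Computable.list_find? (Primrec.list_range.to_comp.comp (Computable.fst.comp .snd))
        ((computable_viol hvs hT).comp (Computable.snd.comp (Computable.snd.comp .fst)) .snd)
    · exact Computable.list_cons.comp .snd (Computable.snd.comp (Computable.snd.comp .fst))
  · induction n with
    | zero => rfl
    | succ n ih => simp only [ih, proc]

theorem computable_req (hvs : Computable vs) : Computable (req vs) := by
  refine (Computable.fst.comp (Computable.list_foldl (f := fun L : List ℕ => L.reverse)
    (g := fun _ => (([] : List (ℕ × Bool)), ([] : List ℕ)))
    (h := fun _ (p : (List (ℕ × Bool) × List ℕ) × ℕ) =>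
      ((vs p.2).map (fun e => (Nat.pair e.1 (cnt vs p.1.2 e.1), !e.2)) ++ p.1.1, p.2 :: p.1.2))
    Computable.list_reverse (Computable.const _) ?_)).of_eq fun L => ?_
  · have hp : Computable fun q : List ℕ × (List (ℕ × Bool) × List ℕ) × ℕ => q.2 := Computable.snd
    have hB := Computable.snd.comp hp
    have hL := Computable.snd.comp (Computable.fst.comp hp)
    refine Computable.pair (Computable.list_append.comp ?_ (Computable.fst.comp
      (Computable.fst.comp hp))) (Computable.list_cons.comp hB hL)
    exact Computable.list_map (hvs.comp hB) (Computable.pair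
      ((computable_pair_cnt hvs).comp (hL.comp .fst) (Computable.fst.comp .snd))
      (Primrec.not.to_comp.comp (Computable.snd.comp .snd)))
  · rw [List.foldl_reverse]
    suffices h : L.foldr (fun B (p : List (ℕ × Bool) × List ℕ) =>
        ((vs B).map (fun e => (Nat.pair e.1 (cnt vs p.2 e.1), !e.2)) ++ p.1, B :: p.2))
        ([], []) = (req vs L, L) from congrArg Prod.fst h
    induction L with
    | nil => rfl
    | cons B L ih => rw [List.foldr_cons, ih, req]

variable {cl : ℕ → ℕ → List ℕ}

theorem computable_step (hvs : Computable vs) (hcl : Computable₂ cl) :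
    Computable₂ fun b s => step vs (cl b) s := by
  have hs : Computable fun p : ℕ × List ℕ × List (Bool × ℕ) => p.2 := Computable.snd
  have hacc := Computable.fst.comp hs
  have hstk := Computable.snd.comp hs
  have htail := Primrec.list_tail.to_comp.comp hstk
  refine (Computable.option_casesOn
    (o := fun p : ℕ × List ℕ × List (Bool × ℕ) => p.2.2.head?)
    (f := fun p => [(p.2.1, [])])
    (g := fun p x => bif x.1 then [(x.2 :: p.2.1, p.2.2.tail)] else (p.2.1, p.2.2.tail) ::
      (cl p.1 x.2).map fun A =>
        (p.2.1, (vars vs A).map (Prod.mk false) ++ (true, A) :: p.2.2.tail))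
    (Primrec.list_head?.to_comp.comp hstk)
    (Computable.list_cons.comp (Computable.pair hacc (Computable.const [])) (Computable.const []))
    (Computable.cond (Computable.fst.comp .snd)
      (Computable.list_cons.comp (Computable.pair (Computable.list_cons.comp
        (Computable.snd.comp .snd) (hacc.comp .fst)) (htail.comp .fst)) (Computable.const []))
      (Computable.list_cons.comp (Computable.pair (hacc.comp .fst) (htail.comp .fst))
        (Computable.list_map (hcl.comp (Computable.fst.comp .fst) (Computable.snd.comp .snd))
          ?_)))).of_eq fun p => ?_
  · refine Computable.pair (hacc.comp (Computable.fst.comp .fst)) (Computable.list_append.comp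
      (Computable.list_map ((computable_vars hvs).comp .snd)
        (Computable.pair (Computable.const false) .snd))
      (Computable.list_cons.comp (Computable.pair (Computable.const true) .snd)
        (htail.comp (Computable.fst.comp .fst))))
  · obtain ⟨b, acc, _ | ⟨⟨_ | _, u⟩, stk⟩⟩ := p <;> rfl

theorem computable_run (hvs : Computable vs) (hcl : Computable₂ cl) :
    Computable fun p : ℕ × ℕ => run vs (cl p.1) (2 * p.1 + 1) ([], [(false, p.2)]) := by
  refine Computable.nat_rec (f := fun p : ℕ × ℕ => 2 * p.1 + 1)
    (g := fun p => [(([] : List ℕ), [(false, p.2)])])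
    (h := fun p (q : ℕ × List (List ℕ × List (Bool × ℕ))) => q.2.flatMap (step vs (cl p.1)))
    ?_ ?_ ?_
  · exact Computable.succ.comp ((Primrec.nat_mul.to_comp).comp (Computable.const 2) .fst)
  · exact Computable.list_cons.comp (Computable.pair (Computable.const []) (Computable.list_cons.comp
      (Computable.pair (Computable.const false) .snd) (Computable.const []))) (Computable.const [])
  · exact Computable.list_flatMap (Computable.snd.comp .snd)
      ((computable_step hvs hcl).comp (Computable.fst.comp (Computable.fst.comp .fst)) .snd)

theorem computable_reqs (hvs : Computable vs) (hcl : Computable₂ cl) :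
    Computable fun p : ℕ × ℕ × ℕ => reqs vs (cl p.1) p.1 p.2.1 p.2.2 := by
  have hrun : Computable fun p : ℕ × ℕ × ℕ =>
      run vs (cl p.1) (2 * p.1 + 1) ([], [(false, p.2.2)]) :=
    (computable_run hvs hcl).comp (g := fun p : ℕ × ℕ × ℕ => (p.1, p.2.2))
      (Computable.pair .fst (Computable.snd.comp .snd))
  have hg : Computable₂ fun (p : ℕ × ℕ × ℕ) (s : List ℕ × List (Bool × ℕ)) =>
      bif s.2.length == 0 && decide (p.2.1 ≤ size vs s.1) then [req vs s.1] else [] := by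
    refine Computable.cond ?_ ?_ (Computable.const [])
    · exact Primrec.and.to_comp.comp ((Primrec.beq (α := ℕ)).to_comp.comp
        (Computable.list_length.comp (Computable.snd.comp .snd)) (Computable.const 0))
        ((PrimrecRel.decide Primrec.nat_le).to_comp.comp
          (Computable.fst.comp (Computable.snd.comp .fst))
          ((computable_size hvs).comp (Computable.fst.comp .snd)))
    · exact Computable.list_cons.comp ((computable_req hvs).comp (Computable.fst.comp .snd))
        (Computable.const [])
  simp only [reqs]
  exact Computable.list_flatMap hrun hg

/-- A computable source of bits for which every legal log whose entries all influence the variable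
`n` is small. -/
theorem exists_computable_source (hvs : Computable vs) (hcl : Computable₂ cl)
    (hne : ∀ j, vs j ≠ []) (hnd : ∀ j, (vars vs j).Nodup)
    (hmem : ∀ b j, (vs j).length ≤ b → ∀ u ∈ vars vs j, j ∈ cl b u) {z y : ℝ} {K : ℕ}
    (hz : 1 / 2 ≤ z) (hy : 0 ≤ y) (hy2 : y ≤ 2)
    (h : ∀ b u, 1 + ((cl b u).map fun A => (z * y) ^ (vs A).length).sum ≤ y)
    (hK0 : 0 < K) (hK : (1 / (2 * z)) ^ K ≤ 1 / 32) :
    ∃ T : ℕ → Bool, Computable T ∧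
      ∀ n L, Legal vs T L → Conn vs {n} L → size vs L < K * (n + 1) := by
  have hz0 : 0 < z := by linarith
  let R : ℕ → List (List (ℕ × Bool)) := fun s => (List.range (s + 1)).flatMap fun n =>
    reqs vs (cl (K * (s + 2))) (K * (s + 2)) (K * (s + 1)) n
  have hc : Computable R := by
    refine Computable.list_flatMap (Primrec.list_range.to_comp.comp Computable.succ) ?_
    have hm : ∀ d, Computable fun q : ℕ × ℕ => K * (q.1 + d) := fun d =>
      (Primrec.nat_mul.to_comp).comp (Computable.const K)
        ((Primrec.nat_add.to_comp).comp .fst (Computable.const d))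
    exact (computable_reqs hvs hcl).comp
      (g := fun q : ℕ × ℕ => (K * (q.1 + 2), K * (q.1 + 1), q.2))
      (Computable.pair (hm 2) (Computable.pair (hm 1) .snd))
  have hR : ∀ s, ∀ r ∈ R s, (r.map Prod.fst).Nodup := by
    intro s r hr
    obtain ⟨n, -, hr⟩ := List.mem_flatMap.1 hr
    obtain ⟨st, -, hr⟩ := List.mem_flatMap.1 hr
    rcases hb : (st.2.length == 0 && decide (K * (s + 1) ≤ size vs st.1)) with _ | _
    · simp [hb] at hr
    · rw [hb] at hr
      obtain rfl : r = req vs st.1 := by simpa using hr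
      exact nodup_req hnd _
  have hsum : ∀ s, ((R s).map fun r => (1 / 2 : ℚ) ^ r.length).sum ≤ (1 / 8) ^ (s + 1) := by
    intro s
    rw [← Rat.cast_le (K := ℝ)]
    push_cast
    rw [List.map_map, List.map_flatMap]
    have hsum : ∀ l : List ℕ, ((l.flatMap fun n =>
        (reqs vs (cl (K * (s + 2))) (K * (s + 2)) (K * (s + 1)) n).map
          fun r => (1 / 2 : ℝ) ^ r.length)).sum ≤ l.length * (2 * (1 / 32) ^ (s + 1)) := by
      intro l
      induction l with
      | nil => simp
      | cons n l ih =>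
        have h1 := sum_reqs_le hz hy (h (K * (s + 2))) (K * (s + 2)) (K * (s + 1)) n
        have h2 : (1 / (2 * z)) ^ (K * (s + 1)) ≤ (1 / 32) ^ (s + 1) := by
          rw [pow_mul]
          exact pow_le_pow_left₀ (by positivity) hK _
        have h3 : (1 / (2 * z)) ^ (K * (s + 1)) * y ≤ (1 / 32) ^ (s + 1) * 2 :=
          mul_le_mul h2 hy2 hy (by positivity)
        rw [List.flatMap_cons, List.sum_append, List.length_cons]
        push_cast
        linarith
    refine le_trans (le_of_eq ?_) ((hsum (List.range (s + 1))).trans ?_)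
    · simp [Function.comp_def]
    · have h4 : (s + 1 : ℝ) * 2 ≤ 4 ^ (s + 1) := by
        have := one_add_mul_le_pow (a := (3 : ℝ)) (by norm_num) (s + 1)
        norm_num at this
        have hs : (0 : ℝ) ≤ s := by positivity
        linarith
      calc ((List.range (s + 1)).length : ℝ) * (2 * (1 / 32) ^ (s + 1)) =
            (s + 1) * 2 * (1 / 32) ^ (s + 1) := by rw [List.length_range]; push_cast; ring
        _ ≤ 4 ^ (s + 1) * (1 / 32) ^ (s + 1) := mul_le_mul_of_nonneg_right h4 (by positivity)
        _ = (1 / 8) ^ (s + 1) := by rw [← mul_pow]; norm_num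
  obtain ⟨T, hT, hTR⟩ := PartialEvent.exists_computable_avoiding hc hR hsum
  refine ⟨T, hT, fun n L hL hconn => ?_⟩
  by_contra! hn
  obtain ⟨s, hs⟩ : ∃ s, size vs L / K = s + 1 := Nat.exists_eq_succ_of_ne_zero
    (Nat.div_pos ((Nat.le_mul_of_pos_right _ n.succ_pos).trans hn) hK0).ne'
  have h1 : K * (s + 1) ≤ size vs L := hs ▸ Nat.mul_div_le _ _
  have h2 : size vs L < K * (s + 2) := by
    have := Nat.lt_mul_div_succ (size vs L) hK0
    rwa [hs] at this
  have h3 : n + 1 < s + 2 := Nat.lt_of_mul_lt_mul_left (hn.trans_lt h2)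
  obtain ⟨L', hL', hperm, hrun⟩ := exists_mem_run_of_size_le hne (hmem _) hL hconn h2.le
  refine hTR s (req vs L') (List.mem_flatMap.2 ⟨n, List.mem_range.2 (by omega),
    List.mem_flatMap.2 ⟨_, hrun, ?_⟩⟩) (legal_iff.1 hL')
  rw [← size_perm hperm] at h1
  simp [h1]

/-- An effective Lovász local lemma. -/
theorem exists_computable_coloring (hvs : Computable vs) (hcl : Computable₂ cl)
    (hne : ∀ j, vs j ≠ []) (hnd : ∀ j, (vars vs j).Nodup)
    (hmem : ∀ b j, (vs j).length ≤ b → ∀ u ∈ vars vs j, j ∈ cl b u) {z y : ℝ} {K : ℕ}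
    (hz : 1 / 2 ≤ z) (hy : 0 ≤ y) (hy2 : y ≤ 2)
    (h : ∀ b u, 1 + ((cl b u).map fun A => (z * y) ^ (vs A).length).sum ≤ y)
    (hK0 : 0 < K) (hK : (1 / (2 * z)) ^ K ≤ 1 / 32) :
    ∃ c : ℕ → Bool, Computable c ∧ ∀ j, ∃ e ∈ vs j, c e.1 = e.2 := by
  obtain ⟨T, hT, hsize⟩ :=
    exists_computable_source hvs hcl hne hnd hmem hz hy hy2 h hK0 hK
  obtain ⟨hex, hcol⟩ := exists_coloring (vs := vs) (T := T) (bnd := fun n => K * (n + 1))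
    (F := fun n => (run vs (cl (K * (n + 1))) (2 * (K * (n + 1)) + 1) ([], [(false, n)])).flatMap
      Prod.fst) hne hsize fun n L hL hconn j hj => by
        obtain ⟨L', -, hperm, hrun⟩ :=
          exists_mem_run_of_size_le hne (hmem _) hL hconn (hsize n L hL hconn).le
        exact List.mem_flatMap.2 ⟨_, hrun, hperm.mem_iff.2 hj⟩
  refine ⟨fun n => T (Nat.pair n (cnt vs (proc vs T (Nat.find (hex n))) n)), ?_, hcol⟩
  refine hT.comp ((computable_pair_cnt hvs).comp ((computable_proc hvs hT).comp
    (Computable.nat_find ?_ hex)) Computable.id)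
  refine Computable.list_all (Computable.list_flatMap ((computable_run hvs hcl).comp
    (g := fun p : ℕ × ℕ => (K * (p.1 + 1), p.1)) (Computable.pair ((Primrec.nat_mul.to_comp).comp (Computable.const K)
      (Computable.succ.comp .fst)) .fst)) (Computable.fst.comp .snd))
    (Primrec.not.to_comp.comp ((computable_viol hvs hT).comp
      ((computable_proc hvs hT).comp (Computable.snd.comp .fst)) .snd))

end Computability

end ResampleLog

theorem exists_weights {q : ℝ} (hq0 : 0 < q) (hq1 : q < 1) :
    ∃ (z y : ℝ) (K M : ℕ), 1 / 2 ≤ z ∧ 0 ≤ y ∧ y ≤ 2 ∧ 0 < K ∧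
      (1 / (2 * z)) ^ K ≤ 1 / 32 ∧ 0 < M ∧
      ∀ b, 1 + ∑ i ∈ Finset.range b, (2 : ℝ) ^ (q * (M + i : ℕ)) * (z * y) ^ (M + i) ≤ y := by
  obtain ⟨d, hd, hdq⟩ : ∃ d : ℝ, 0 < d ∧ q + 3 * d = 1 :=
    ⟨(1 - q) / 3, by linarith, by ring⟩
  have hr0 : (0 : ℝ) < 2 ^ (-d) := by positivity
  have hr1 : (2 : ℝ) ^ (-d) < 1 := Real.rpow_lt_one_of_one_lt_of_neg one_lt_two (by linarith)
  have hy1 : (1 : ℝ) < 2 ^ d := Real.one_lt_rpow one_lt_two hd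
  have hz : (1 : ℝ) / (2 * 2 ^ (d - 1)) = 2 ^ (-d) := by
    rw [Real.rpow_sub two_pos, Real.rpow_neg two_pos.le, Real.rpow_one]
    field_simp
  have hr : (2 : ℝ) ^ q * (2 ^ (d - 1) * 2 ^ d) = 2 ^ (-d) := by
    rw [← Real.rpow_add two_pos, ← Real.rpow_add two_pos]
    congr 1
    linarith
  obtain ⟨K, hK⟩ := exists_pow_lt_of_lt_one (show (0 : ℝ) < 1 / 32 by norm_num) hr1
  obtain ⟨M, hM⟩ := exists_pow_lt_of_lt_one
    (mul_pos (sub_pos.2 hy1) (sub_pos.2 hr1)) hr1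
  refine ⟨2 ^ (d - 1), 2 ^ d, K, M + 1, ?_, by positivity, ?_, ?_, hz ▸ hK.le,
    M.succ_pos, fun b => ?_⟩
  · rw [Real.rpow_sub two_pos, Real.rpow_one]
    linarith
  · calc (2 : ℝ) ^ d ≤ 2 ^ (1 : ℝ) := Real.rpow_le_rpow_of_exponent_le one_le_two (by linarith)
      _ = 2 := Real.rpow_one 2
  · rcases K.eq_zero_or_pos with rfl | h
    · norm_num at hK
    · exact h
  · have hterm : ∀ i : ℕ, (2 : ℝ) ^ (q * (M + 1 + i : ℕ)) * (2 ^ (d - 1) * 2 ^ d) ^ (M + 1 + i) =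
        (2 ^ (-d)) ^ (M + 1) * (2 ^ (-d)) ^ i := fun i => by
      rw [Real.rpow_mul two_pos.le, Real.rpow_natCast, ← mul_pow, hr, pow_add]
    rw [Finset.sum_congr rfl fun i _ => hterm i, ← Finset.mul_sum]
    have hgeom : (∑ i ∈ Finset.range b, ((2 : ℝ) ^ (-d)) ^ i) * (1 - 2 ^ (-d)) ≤ 1 := by
      rw [geom_sum_mul_neg]
      have : (0 : ℝ) ≤ (2 ^ (-d)) ^ b := by positivity
      linarith
    have hpow : ((2 : ℝ) ^ (-d)) ^ (M + 1) ≤ (2 ^ d - 1) * (1 - 2 ^ (-d)) :=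
      (pow_le_pow_of_le_one hr0.le hr1.le M.le_succ).trans hM.le
    have hS : (0 : ℝ) ≤ ∑ i ∈ Finset.range b, ((2 : ℝ) ^ (-d)) ^ i := by positivity
    nlinarith [mul_le_mul_of_nonneg_right hpow hS,
      mul_le_mul_of_nonneg_left hgeom (sub_pos.2 hy1).le]

/-- **Effective avoidance via the Lovász Local Lemma (partial-function version,
Rumyantsev–Shen).** For each rational `0 < q < 1` there is an `M` such that: whenever
`σ : ℕ → Finset (ℕ × Bool)` is a computable sequence of (graphs of) finite partial
functions, each of size at least `M`, and there is a computable `G` such that for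
`m ≥ M` and each `n`, `G m n` is exactly the set of `j` such that `σ j` has size `m`
and `n` is in the domain of `σ j`, and this set has at most `2^(q·m)` elements, then
there is a computable coloring `c : ℕ → Bool` agreeing with each `σ j` somewhere,
i.e. for each `j` there is `(n, b) ∈ σ j` with `c n = b`.

(Computability of the sequence `σ` is expressed via the canonical encoding of
`Finset (ℕ × Bool)`.) -/
theorem stmt_15 (q : ℚ) (hq0 : 0 < q) (hq1 : q < 1) :
    ∃ M : ℕ, ∀ σ : ℕ → Finset (ℕ × Bool),
      Computable (fun j => Encodable.encode (σ j)) →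
      (∀ j, ∀ p ∈ σ j, ∀ p' ∈ σ j, (p : ℕ × Bool).1 = (p' : ℕ × Bool).1 → p = p') →
      (∀ j, M ≤ (pdom (σ j)).card) →
      ∀ G : ℕ → ℕ → Finset ℕ, Computable₂ G →
        (∀ m, M ≤ m → ∀ n,
          (∀ j, j ∈ G m n ↔ (pdom (σ j)).card = m ∧ n ∈ pdom (σ j)) ∧
          ((G m n).card : ℝ) ≤ (2 : ℝ) ^ ((q : ℝ) * (m : ℝ))) →
        ∃ c : ℕ → Bool, Computable c ∧
          ∀ j, ∃ p ∈ σ j, c (p : ℕ × Bool).1 = (p : ℕ × Bool).2 := by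
  obtain ⟨z, y, K, M, hz, hy, hy2, hK0, hK, hM, hsum⟩ :=
    exists_weights (q := (q : ℝ)) (by exact_mod_cast hq0) (by exact_mod_cast hq1)
  refine ⟨M, fun σ hσ hfun hcard G hG hGspec => ?_⟩
  obtain ⟨vs, hvs, hmem⟩ := Computable.exists_list_of_encode_finset hσ
  obtain ⟨g, hg, hgmem⟩ := Computable₂.exists_list_of_finset hG
  have hnd : ∀ j, (ResampleLog.vars vs j).Nodup := fun j =>
    List.Nodup.map_on (fun e he e' he' h => hfun j e (((hmem j).2 e).1 he) e'
      (((hmem j).2 e').1 he') h) (hmem j).1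
  have hdom : ∀ j, (ResampleLog.vars vs j).toFinset = pdom (σ j) := fun j => by
    ext v
    simp [ResampleLog.vars, pdom, (hmem j).2]
  have hlen : ∀ j, (pdom (σ j)).card = (vs j).length := fun j => by
    rw [← hdom, List.toFinset_card_of_nodup (hnd j), ResampleLog.vars, List.length_map]
  have hspec : ∀ i u j, j ∈ g (M + i) u ↔
      (vs j).length = M + i ∧ u ∈ ResampleLog.vars vs j := fun i u j => by
    rw [(hgmem _ _).2, (hGspec _ (Nat.le_add_right M i) u).1, hlen, ← hdom, List.mem_toFinset]
  let cl : ℕ → ℕ → List ℕ := fun b u => (List.range b).flatMap fun i => g (M + i) u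
  have hcl : Computable₂ cl :=
    Computable.list_flatMap (Primrec.list_range.to_comp.comp .fst)
      (hg.comp ((Primrec.nat_add.to_comp).comp (Computable.const M) .snd)
        (Computable.snd.comp .fst))
  have hle : ∀ j, M ≤ (vs j).length := fun j => hlen j ▸ hcard j
  have hne : ∀ j, vs j ≠ [] := fun j => List.length_pos_iff.1 (hM.trans_le (hle j))
  have hmem_cl : ∀ b j, (vs j).length ≤ b → ∀ u ∈ ResampleLog.vars vs j, j ∈ cl b u := by
    intro b j hj u hu
    have h := hle j
    exact List.mem_flatMap.2 ⟨(vs j).length - M, List.mem_range.2 (by omega),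
      (hspec _ u j).2 ⟨by omega, hu⟩⟩
  have hweight : ∀ b u, 1 + ((cl b u).map fun A => (z * y) ^ (vs A).length).sum ≤ y := by
    intro b u
    refine le_trans (add_le_add_right ?_ 1) (hsum b)
    induction b with
    | zero => simp [cl]
    | succ b ih =>
      have hconst : (g (M + b) u).map (fun A => (z * y) ^ (vs A).length) =
          (g (M + b) u).map fun _ => (z * y) ^ (M + b) :=
        List.map_congr_left fun A hA => by rw [((hspec b u A).1 hA).1]
      have hcount : ((g (M + b) u).length : ℝ) ≤ 2 ^ ((q : ℝ) * (M + b : ℕ)) := by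
        rw [← List.toFinset_card_of_nodup (hgmem _ _).1,
          show (g (M + b) u).toFinset = G (M + b) u by ext j; simp [(hgmem _ _).2]]
        exact (hGspec _ (Nat.le_add_right M b) u).2
      simp only [cl] at ih ⊢
      rw [List.range_succ, List.flatMap_append, List.map_append, List.sum_append,
        Finset.sum_range_succ, List.flatMap_singleton, hconst, List.map_const', List.sum_replicate,
        nsmul_eq_mul]
      exact add_le_add ih (mul_le_mul_of_nonneg_right hcount (by positivity))
  obtain ⟨c, hc, hcol⟩ := ResampleLog.exists_computable_coloring hvs hcl hne hnd hmem_cl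
    hz hy hy2 hweight hK0 hK
  refine ⟨c, hc, fun j => ?_⟩
  obtain ⟨e, he, hce⟩ := hcol j
  exact ⟨e, ((hmem j).2 e).1 he, hce⟩
end

section
/- (Infinite Asymmetric Lovász Local Lemma.) Let f : ℕ → ℕ and for each n let p n : ℕ → ℝ be a probability distribution on {0, …, f n}, i.e., p n k ≥ 0 for all k and the sum of p n k over k ≤ f n equals 1. For each j ∈ ℕ let vbl j be a finite subset of ℕ and let A j be a finite set of functions σ : ℕ → ℕ with σ n ≤ f n for all n ∈ vbl j, where membership of σ in A j depends only on the restriction of σ to vbl j (i.e., if σ and τ agree on vbl j then σ ∈ A j ↔ τ ∈ A j). Define Pr j to be the sum, over the finitely many restrictions to vbl j of elements of A j, of the product over n ∈ vbl j of p n (σ n). Assume each n belongs to vbl j for only finitely many j (so each N j = {t | vbl t ∩ vbl j ≠ ∅} is finite). Suppose there exist reals r j ∈ (0,1) such that for all j, Pr j ≤ r j · ∏_{t ∈ N j, t ≠ j} (1 − r t). Then there is an assignment h : ℕ → ℕ with h n ≤ f n for all n such that h avoids every event: for every j, h ∉ A j. -/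
open Finset

/-- The probability of the event `A` (a set of assignments depending only on the
variables in `vbl`) under the product of the distributions `p n` on `{0, …, f n}`:
the sum, over all restrictions `σ` assigning to each `n ∈ vbl` a value `≤ f n` whose
extension by `0` lies in `A`, of `∏_{n ∈ vbl} p n (σ n)`. -/
noncomputable def eventPr (f : ℕ → ℕ) (p : ℕ → ℕ → ℝ) (vbl : Finset ℕ)
    (A : Set (ℕ → ℕ)) : ℝ :=
  ∑ σ ∈ vbl.pi (fun n => Finset.range (f n + 1)),
    Set.indicator A (fun _ => ∏ x ∈ vbl.attach, p x.1 (σ x.1 x.2))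
      (fun n => if h : n ∈ vbl then σ n h else 0)

open MeasureTheory ProbabilityTheory

/-- An event determined by the coordinates in `s` is a preimage under restriction to `s`. -/
lemma DependsOn.preimage_restrict_image {ι : Type*} {X : ι → Type*} {A : Set (∀ i, X i)}
    {s : Finset ι} (hA : DependsOn (· ∈ A) (s : Set ι)) :
    (s.restrict : (∀ i, X i) → ∀ i : s, X i) ⁻¹' (s.restrict '' A) = A := by
  refine Set.Subset.antisymm ?_ (Set.subset_preimage_image _ _)
  rintro x ⟨y, hy, hyx⟩
  exact (hA fun i hi ↦ congrFun hyx ⟨i, hi⟩).mp hy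

lemma DependsOn.measurableSet {ι : Type*} {A : Set (ι → ℕ)} {s : Finset ι}
    (hA : DependsOn (· ∈ A) (s : Set ι)) : MeasurableSet A := by
  rw [← hA.preimage_restrict_image]
  exact s.measurable_restrict (MeasurableSet.of_discrete)

lemma DependsOn.isOpen {ι : Type*} {A : Set (ι → ℕ)} {s : Finset ι}
    (hA : DependsOn (· ∈ A) (s : Set ι)) : IsOpen A := by
  rw [← hA.preimage_restrict_image]
  exact (isOpen_discrete _).preimage (by fun_prop)

/-- Under a product measure, events determined by disjoint finite sets of coordinates are
independent. -/
lemma DependsOn.measureReal_inter_infinitePi {ι : Type*} (ν : ι → Measure ℕ)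
    [∀ i, IsProbabilityMeasure (ν i)] {A B : Set (ι → ℕ)} {s t : Finset ι}
    (hA : DependsOn (· ∈ A) (s : Set ι)) (hB : DependsOn (· ∈ B) (t : Set ι))
    (hst : Disjoint s t) :
    (Measure.infinitePi ν).real (A ∩ B) =
      (Measure.infinitePi ν).real A * (Measure.infinitePi ν).real B := by
  have hind : iIndepFun (fun i (x : ι → ℕ) ↦ x i) (Measure.infinitePi ν) :=
    iIndepFun_infinitePi (X := fun _ ↦ id) fun _ ↦ measurable_id
  have h := (hind.indepFun_finset s t hst fun i ↦ measurable_pi_apply i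
    ).measure_inter_preimage_eq_mul (s.restrict '' A) (t.restrict '' B)
      .of_discrete .of_discrete
  change Measure.infinitePi ν (s.restrict ⁻¹' _ ∩ t.restrict ⁻¹' _) =
    Measure.infinitePi ν (s.restrict ⁻¹' _) * Measure.infinitePi ν (t.restrict ⁻¹' _) at h
  rw [hA.preimage_restrict_image, hB.preimage_restrict_image] at h
  simp only [measureReal_def, h, ENNReal.toReal_mul]

section LocalLemma

variable {Ω ι : Type*} [MeasurableSpace Ω] {μ : Measure Ω} [IsProbabilityMeasure μ]
  {A : ι → Set Ω} {r : ι → ℝ}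

/-- One step of the chain rule: removing one more event of conditional probability at most `r t`
costs a factor of at most `1 - r t`. -/
lemma mul_measureReal_iInter_compl_le_insert [DecidableEq ι] {S : Finset ι} {t : ι}
    (ht : MeasurableSet (A t))
    (h : μ.real (A t ∩ ⋂ i ∈ S, (A i)ᶜ) ≤ r t * μ.real (⋂ i ∈ S, (A i)ᶜ)) :
    (1 - r t) * μ.real (⋂ i ∈ S, (A i)ᶜ) ≤ μ.real (⋂ i ∈ insert t S, (A i)ᶜ) := by
  have hsplit := measureReal_inter_add_sdiff (μ := μ) (s := ⋂ i ∈ S, (A i)ᶜ) ht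
  have hset : (⋂ i ∈ insert t S, (A i)ᶜ) = (⋂ i ∈ S, (A i)ᶜ) \ A t := by
    rw [Finset.set_biInter_insert, Set.inter_comm, Set.sdiff_eq]
  rw [Set.inter_comm] at hsplit
  rw [hset]
  linarith

variable [DecidableEq ι] {N : ι → Finset ι}

/-- The key estimate of the asymmetric Lovász Local Lemma: conditioned on avoiding finitely many
other events, `A j` has probability at most `r j`. -/
lemma measureReal_inter_iInter_compl_le (hA : ∀ j, MeasurableSet (A j))
    (hr : ∀ j, r j ∈ Set.Ioo (0 : ℝ) 1)
    (hind : ∀ j (S : Finset ι), Disjoint S (N j) →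
      μ.real (A j ∩ ⋂ i ∈ S, (A i)ᶜ) = μ.real (A j) * μ.real (⋂ i ∈ S, (A i)ᶜ))
    (hPr : ∀ j, μ.real (A j) ≤ r j * ∏ t ∈ (N j).erase j, (1 - r t)) (S : Finset ι) :
    ∀ j ∉ S, μ.real (A j ∩ ⋂ i ∈ S, (A i)ᶜ) ≤ r j * μ.real (⋂ i ∈ S, (A i)ᶜ) := by
  induction S using Finset.strongInduction with
  | H S ih =>
    intro j hj
    have hr0 : ∀ t, 0 ≤ 1 - r t := fun t ↦ by linarith [(hr t).2]
    have hchain : ∀ T ⊆ S ∩ N j, (∏ t ∈ T, (1 - r t)) * μ.real (⋂ i ∈ S \ N j, (A i)ᶜ) ≤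
        μ.real (⋂ i ∈ T ∪ S \ N j, (A i)ᶜ) := by
      intro T
      induction T using Finset.induction_on with
      | empty => simp
      | insert t T htT ihT =>
        intro hT
        have ht := Finset.mem_inter.mp (hT (Finset.mem_insert_self t T))
        have hTS := (Finset.subset_insert t T).trans hT
        have htU : t ∉ T ∪ S \ N j := by simp [htT, ht.2]
        have hU : T ∪ S \ N j ⊂ S := by
          refine (Finset.ssubset_iff_of_subset ?_).mpr ⟨t, ht.1, htU⟩
          exact Finset.union_subset (hTS.trans Finset.inter_subset_left) Finset.sdiff_subset
        have hstep := mul_measureReal_iInter_compl_le_insert (hA t) (ih _ hU t htU)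
        rw [Finset.prod_insert htT, mul_assoc, Finset.insert_union]
        exact (mul_le_mul_of_nonneg_left (ihT hTS) (hr0 t)).trans hstep
    have hS := hchain _ Finset.Subset.rfl
    rw [Finset.union_comm, Finset.sdiff_union_inter] at hS
    have hprod : ∏ t ∈ (N j).erase j, (1 - r t) ≤ ∏ t ∈ S ∩ N j, (1 - r t) := by
      refine Finset.prod_le_prod_of_subset_of_le_one ?_ (fun t _ ↦ hr0 t)
        fun t _ _ ↦ by linarith [(hr t).1]
      intro t ht
      rw [Finset.mem_inter] at ht
      exact Finset.mem_erase.mpr ⟨fun h ↦ hj (h ▸ ht.1), ht.2⟩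
    calc μ.real (A j ∩ ⋂ i ∈ S, (A i)ᶜ)
        ≤ μ.real (A j ∩ ⋂ i ∈ S \ N j, (A i)ᶜ) :=
          measureReal_mono (Set.inter_subset_inter_right _
            (Set.biInter_subset_biInter_left fun i hi ↦ (Finset.mem_sdiff.mp hi).1))
      _ = μ.real (A j) * μ.real (⋂ i ∈ S \ N j, (A i)ᶜ) := hind j _ Finset.sdiff_disjoint
      _ ≤ (r j * ∏ t ∈ S ∩ N j, (1 - r t)) * μ.real (⋂ i ∈ S \ N j, (A i)ᶜ) :=
          mul_le_mul_of_nonneg_right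
            ((hPr j).trans (mul_le_mul_of_nonneg_left hprod (hr j).1.le)) measureReal_nonneg
      _ ≤ r j * μ.real (⋂ i ∈ S, (A i)ᶜ) := by
          rw [mul_assoc]
          exact mul_le_mul_of_nonneg_left hS (hr j).1.le

/-- The asymmetric Lovász Local Lemma for finitely many events. -/
lemma measureReal_iInter_compl_pos (hA : ∀ j, MeasurableSet (A j))
    (hr : ∀ j, r j ∈ Set.Ioo (0 : ℝ) 1)
    (hind : ∀ j (S : Finset ι), Disjoint S (N j) →
      μ.real (A j ∩ ⋂ i ∈ S, (A i)ᶜ) = μ.real (A j) * μ.real (⋂ i ∈ S, (A i)ᶜ))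
    (hPr : ∀ j, μ.real (A j) ≤ r j * ∏ t ∈ (N j).erase j, (1 - r t)) (S : Finset ι) :
    0 < μ.real (⋂ i ∈ S, (A i)ᶜ) := by
  induction S using Finset.induction_on with
  | empty => simp
  | insert t S ht ih =>
    exact (mul_pos (sub_pos.mpr (hr t).2) ih).trans_le <|
      mul_measureReal_iInter_compl_le_insert (hA t)
        (measureReal_inter_iInter_compl_le hA hr hind hPr S t ht)

end LocalLemma

/-- The measure on `ℕ` with weights `q k` on `{0, …, m}`. -/
noncomputable def weightMeasure (m : ℕ) (q : ℕ → ℝ) : Measure ℕ :=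
  ∑ k ∈ Finset.range (m + 1), ENNReal.ofReal (q k) • Measure.dirac k

lemma weightMeasure_apply (m : ℕ) (q : ℕ → ℝ) (s : Set ℕ) :
    weightMeasure m q s =
      ∑ k ∈ Finset.range (m + 1), ENNReal.ofReal (q k) * s.indicator 1 k := by
  simp [weightMeasure, Measure.finsetSum_apply]

lemma isProbabilityMeasure_weightMeasure {m : ℕ} {q : ℕ → ℝ} (hq0 : ∀ k, 0 ≤ q k)
    (hq1 : ∑ k ∈ Finset.range (m + 1), q k = 1) : IsProbabilityMeasure (weightMeasure m q) := by
  constructor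
  rw [weightMeasure_apply]
  simp [← ENNReal.ofReal_sum_of_nonneg fun k _ ↦ hq0 k, hq1]

lemma weightMeasure_singleton {m : ℕ} (q : ℕ → ℝ) {k : ℕ} (hk : k ≤ m) :
    weightMeasure m q {k} = ENNReal.ofReal (q k) := by
  rw [weightMeasure_apply, Finset.sum_eq_single k]
  · simp
  · intro b _ hb
    simp [hb]
  · intro h
    exact absurd (Finset.mem_range_succ_iff.mpr hk) h

lemma ae_weightMeasure_le (m : ℕ) (q : ℕ → ℝ) : ∀ᵐ k ∂weightMeasure m q, k ≤ m := by
  rw [ae_iff, weightMeasure_apply]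
  refine Finset.sum_eq_zero fun k hk ↦ ?_
  simp [Finset.mem_range_succ_iff.mp hk]

lemma measureReal_infinitePi_le_eventPr {f : ℕ → ℕ} {p : ℕ → ℕ → ℝ} (hp0 : ∀ n k, 0 ≤ p n k)
    [∀ n, IsProbabilityMeasure (weightMeasure (f n) (p n))] {s : Finset ℕ} {A : Set (ℕ → ℕ)}
    (hA : DependsOn (· ∈ A) (s : Set ℕ)) (hAval : ∀ σ ∈ A, ∀ n ∈ s, σ n ≤ f n) :
    (Measure.infinitePi fun n ↦ weightMeasure (f n) (p n)).real A ≤ eventPr f p s A := by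
  classical
  let ext (σ : ∀ n ∈ s, ℕ) : ℕ → ℕ := fun n ↦ if h : n ∈ s then σ n h else 0
  let R := s.pi fun n ↦ Finset.range (f n + 1)
  have hcover : A ⊆ ⋃ σ ∈ R.filter fun σ ↦ ext σ ∈ A, (s : Set ℕ).pi fun n ↦ {ext σ n} := by
    intro x hx
    have hxs : ∀ n ∈ s, ext (fun n _ ↦ x n) n = x n := fun n hn ↦ by simp [ext, hn]
    refine Set.mem_biUnion (x := fun n _ ↦ x n) ?_ fun n hn ↦ (hxs n hn).symm
    refine Finset.mem_filter.mpr ⟨?_, (hA hxs).mpr hx⟩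
    exact Finset.mem_pi.mpr fun n hn ↦ Finset.mem_range_succ_iff.mpr (hAval x hx n hn)
  refine (measureReal_mono hcover (measure_ne_top _ _)).trans ((measureReal_biUnion_finset_le _ _).trans ?_)
  rw [Finset.sum_filter]
  refine Finset.sum_le_sum fun σ hσ ↦ ?_
  by_cases hσA : ext σ ∈ A
  · rw [if_pos hσA, Set.indicator_of_mem hσA, measureReal_def,
      Measure.infinitePi_pi _ fun _ _ ↦ .of_discrete, ENNReal.toReal_prod,
      ← Finset.prod_attach]
    refine (Finset.prod_congr rfl fun n _ ↦ ?_).le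
    have hle : σ n.1 n.2 ≤ f n.1 := Finset.mem_range_succ_iff.mp (Finset.mem_pi.mp hσ _ n.2)
    have hext : ext σ n.1 = σ n.1 n.2 := dif_pos n.2
    rw [hext, weightMeasure_singleton _ hle, ENNReal.toReal_ofReal (hp0 _ _)]
  · rw [if_neg hσA, Set.indicator_of_notMem hσA]

/-- **Infinite Asymmetric Lovász Local Lemma.** Let each variable `x n` range over
`{0, …, f n}` with probability distribution `p n`. Let `A j` be events, `A j`
depending only on the finitely many variables in `vbl j` and containing only
assignments valid on `vbl j`; let `N j` (a finite set) consist of all `t` with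
`vbl t ∩ vbl j ≠ ∅`. If there are reals `r j ∈ (0,1)` with
`Pr[A j] ≤ r j · ∏_{t ∈ N j, t ≠ j} (1 - r t)` for all `j`, then some assignment
`h` (with `h n ≤ f n` for all `n`) avoids every event `A j`. -/
theorem stmt_16 (f : ℕ → ℕ) (p : ℕ → ℕ → ℝ)
    (hp0 : ∀ n k, 0 ≤ p n k)
    (hp1 : ∀ n, ∑ k ∈ Finset.range (f n + 1), p n k = 1)
    (vbl : ℕ → Finset ℕ) (A : ℕ → Set (ℕ → ℕ))
    (hAdep : ∀ j, ∀ σ τ : ℕ → ℕ, (∀ n ∈ vbl j, σ n = τ n) → (σ ∈ A j ↔ τ ∈ A j))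
    (hAval : ∀ j, ∀ σ ∈ A j, ∀ n ∈ vbl j, σ n ≤ f n)
    (N : ℕ → Finset ℕ)
    (hN : ∀ j t, t ∈ N j ↔ (vbl t ∩ vbl j).Nonempty)
    (r : ℕ → ℝ) (hr : ∀ j, r j ∈ Set.Ioo (0 : ℝ) 1)
    (hPr : ∀ j, eventPr f p (vbl j) (A j) ≤ r j * ∏ t ∈ (N j).erase j, (1 - r t)) :
    ∃ h : ℕ → ℕ, (∀ n, h n ≤ f n) ∧ ∀ j, h ∉ A j := by
  have hprob : ∀ n, IsProbabilityMeasure (weightMeasure (f n) (p n)) := fun n ↦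
    isProbabilityMeasure_weightMeasure (hp0 n) (hp1 n)
  let μ := Measure.infinitePi fun n ↦ weightMeasure (f n) (p n)
  have hdep : ∀ j, DependsOn (· ∈ A j) (vbl j : Set ℕ) := fun j σ τ h ↦
    propext (hAdep j σ τ h)
  have hind : ∀ j (S : Finset ℕ), Disjoint S (N j) →
      μ.real (A j ∩ ⋂ i ∈ S, (A i)ᶜ) = μ.real (A j) * μ.real (⋂ i ∈ S, (A i)ᶜ) := by
    intro j S hS
    refine (hdep j).measureReal_inter_infinitePi _ (t := S.biUnion vbl) ?_ ?_
    · intro σ τ h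
      simp only [Set.mem_iInter, Set.mem_compl_iff]
      refine propext (forall₂_congr fun i hi ↦ not_congr (hAdep i σ τ fun n hn ↦ h n ?_))
      exact Finset.mem_coe.mpr (Finset.mem_biUnion.mpr ⟨i, hi, hn⟩)
    · rw [Finset.disjoint_biUnion_right]
      intro i hi
      have hiN := Finset.disjoint_left.mp hS hi
      rwa [hN, Finset.not_nonempty_iff_eq_empty, ← Finset.disjoint_iff_inter_eq_empty,
        disjoint_comm] at hiN
  have hpos := measureReal_iInter_compl_pos (fun j ↦ (hdep j).measurableSet) hr hind
    fun j ↦ (measureReal_infinitePi_le_eventPr hp0 (hdep j) (hAval j)).trans (hPr j)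
  have hae : ∀ᵐ x ∂μ, ∀ n, x n ≤ f n := ae_all_iff.mpr fun n ↦
    (measurePreserving_eval_infinitePi (fun n ↦ weightMeasure (f n) (p n)) n
      ).quasiMeasurePreserving.ae (ae_weightMeasure_le (f n) (p n))
  have hcompact : IsCompact (Set.univ.pi fun n ↦ Set.Iic (f n)) :=
    isCompact_univ_pi fun n ↦ (Set.finite_Iic (f n)).isCompact
  obtain ⟨h, hf, hA⟩ := hcompact.inter_iInter_nonempty (fun j ↦ (A j)ᶜ)
    (fun j ↦ (hdep j).isOpen.isClosed_compl) fun S ↦ by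
      have hne : μ (⋂ i ∈ S, (A i)ᶜ) ≠ 0 := fun h0 ↦ by
        simpa [measureReal_def, h0] using hpos S
      obtain ⟨x, hxS, hx⟩ := ((frequently_ae_mem_iff.mpr hne).and_eventually hae).exists
      exact ⟨x, fun n _ ↦ hx n, hxS⟩
  exact ⟨h, fun n ↦ hf n trivial, fun j ↦ Set.mem_iInter.mp hA j⟩
end
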